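/- Fix ϱ > 0 and assume |θ| > ϱ and 1/2 ≤ d·θ² ≤ 1. Set S = E[(π1·Z1 + π2·Z2 − 1)²·(π1·Z1/(π1·Z1 + π2·Z2) − π1)]. For any ε > 0 there exist N = N(π, ε) and δ = δ(π, ε, ϱ) > 0 such that if n ≥ N and x_n ≤ δ then |S| ≤ ε·x_n². -/

import Mathlib

open Finset Filter

namespace AsymIsing

/-- Level-`k` vertices of the rooted `d`-ary tree: paths of length `k` from the root. -/
abbrev Vert (d k : ℕ) : Type := Fin k → Fin d

/-- A spin configuration on levels `0, …, n` of the `d`-ary tree. -/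
abbrev Conf (d n : ℕ) : Type := ∀ k : Fin (n + 1), Vert d k → Fin 2

/-- A spin configuration on level `n` only. -/
abbrev LConf (d n : ℕ) : Type := Vert d n → Fin 2

/-- The transition matrix of the asymmetric binary channel; the paper's state `1`
corresponds to the index `0` and the state `2` to the index `1`. -/
noncomputable def Mmat (θ Δ : ℝ) : Fin 2 → Fin 2 → ℝ := fun i j =>
  if i = 0 then (if j = 0 then (1 + θ - Δ) / 2 else (1 - θ + Δ) / 2)
  else (if j = 0 then (1 - θ - Δ) / 2 else (1 + θ + Δ) / 2)

/-- The stationary distribution `π = (π₁, π₂)` of the channel. -/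
noncomputable def pst (θ Δ : ℝ) : Fin 2 → ℝ := fun i =>
  if i = 0 then 1 / 2 - Δ / (2 * (1 - θ)) else 1 / 2 + Δ / (2 * (1 - θ))

/-- The root spin of a configuration. -/
def root {d n : ℕ} (σ : Conf d n) : Fin 2 := σ ⟨0, n.succ_pos⟩ (fun i => i.elim0)

/-- The restriction of a configuration to the last (`n`-th) level. -/
def top {d n : ℕ} (σ : Conf d n) : LConf d n := σ (Fin.last n)

/-- The probability of a full configuration on levels `0, …, n` under the broadcast
process: the root is drawn from `π` and spins propagate along edges via `M`. -/
noncomputable def confProb (d : ℕ) (θ Δ : ℝ) (n : ℕ) (σ : Conf d n) : ℝ :=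
  pst θ Δ (root σ) *
    ∏ k : Fin n, ∏ v : Vert d (k + 1),
      Mmat θ Δ (σ k.castSucc (v ∘ Fin.castSucc)) (σ k.succ v)

/-- `P(σ(n) = A)`: the marginal law of the level-`n` spins. -/
noncomputable def levelProb (d : ℕ) (θ Δ : ℝ) (n : ℕ) (A : LConf d n) : ℝ :=
  ∑ σ : Conf d n, if top σ = A then confProb d θ Δ n σ else 0

/-- `P(σ_ρ = i, σ(n) = A)`. -/
noncomputable def jointProb (d : ℕ) (θ Δ : ℝ) (n : ℕ) (i : Fin 2) (A : LConf d n) : ℝ :=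
  ∑ σ : Conf d n, if root σ = i ∧ top σ = A then confProb d θ Δ n σ else 0

/-- The posterior `f_n(i, A) = P(σ_ρ = i ∣ σ(n) = A)`. -/
noncomputable def post (d : ℕ) (θ Δ : ℝ) (n : ℕ) (i : Fin 2) (A : LConf d n) : ℝ :=
  jointProb d θ Δ n i A / levelProb d θ Δ n A

/-- The law of `σ^i(n)`, i.e. `P(σ(n) = A ∣ σ_ρ = i)`. -/
noncomputable def condLevel (d : ℕ) (θ Δ : ℝ) (n : ℕ) (i : Fin 2) (A : LConf d n) : ℝ :=
  jointProb d θ Δ n i A / pst θ Δ i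

/-- The total variation distance between `σ^1(n)` and `σ^2(n)`. -/
noncomputable def tvDist (d : ℕ) (θ Δ : ℝ) (n : ℕ) : ℝ :=
  (1 / 2) * ∑ A : LConf d n, |condLevel d θ Δ n 0 A - condLevel d θ Δ n 1 A|

/-- The reconstruction problem is solvable if `limsup_n d_TV(σ^1(n), σ^2(n)) > 0`. -/
def solvable (d : ℕ) (θ Δ : ℝ) : Prop :=
  0 < Filter.limsup (fun n => tvDist d θ Δ n) Filter.atTop

/-- Non-reconstruction: `limsup_n d_TV(σ^1(n), σ^2(n)) = 0`. -/
def nonReconstruction (d : ℕ) (θ Δ : ℝ) : Prop :=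
  Filter.limsup (fun n => tvDist d θ Δ n) Filter.atTop = 0

/-- Expectation of a function of the level-`n` configuration, conditioned on `σ_ρ = 1`. -/
noncomputable def expect1 (d : ℕ) (θ Δ : ℝ) (n : ℕ) (g : LConf d n → ℝ) : ℝ :=
  ∑ A : LConf d n, condLevel d θ Δ n 0 A * g A

/-- `x_n = E f_n(1, σ^1(n)) − π₁`. -/
noncomputable def xseq (d : ℕ) (θ Δ : ℝ) (n : ℕ) : ℝ :=
  expect1 d θ Δ n (fun A => post d θ Δ n 0 A) - pst θ Δ 0

/-- `z_n = E (f_n(1, σ^1(n)) − π₁)²`. -/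
noncomputable def zseq (d : ℕ) (θ Δ : ℝ) (n : ℕ) : ℝ :=
  expect1 d θ Δ n (fun A => (post d θ Δ n 0 A - pst θ Δ 0) ^ 2)

/-- The restriction of a level-`(n+1)` configuration to the subtree of the `j`-th
child of the root (paths starting with `j`). -/
def restrictChild {d n : ℕ} (j : Fin d) (A : LConf d (n + 1)) : LConf d n :=
  fun w => A (Fin.cons j w)

/-- `Y_j = f_n(1, σ_j(n+1))`, as a function of the level-`(n+1)` configuration. -/
noncomputable def Yfun (d : ℕ) (θ Δ : ℝ) (n : ℕ) (j : Fin d) (A : LConf d (n + 1)) : ℝ :=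
  post d θ Δ n 0 (restrictChild j A)

/-- `Z₁ = ∏_j (1 + (θ/π₁)(Y_j − π₁))`, as a function of the level-`(n+1)` configuration. -/
noncomputable def Z1fun (d : ℕ) (θ Δ : ℝ) (n : ℕ) (A : LConf d (n + 1)) : ℝ :=
  ∏ j : Fin d, (1 + (θ / pst θ Δ 0) * (Yfun d θ Δ n j A - pst θ Δ 0))

/-- `Z₂ = ∏_j (1 − (θ/π₂)(Y_j − π₁))`, as a function of the level-`(n+1)` configuration. -/
noncomputable def Z2fun (d : ℕ) (θ Δ : ℝ) (n : ℕ) (A : LConf d (n + 1)) : ℝ :=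
  ∏ j : Fin d, (1 - (θ / pst θ Δ 1) * (Yfun d θ Δ n j A - pst θ Δ 0))

/-- The value of `Δ` making `π = (π₁, π₂)` the stationary distribution of the channel
with second eigenvalue `θ`, namely `Δ = (1 − θ)(π₂ − π₁)`. -/
noncomputable def Dlt (θ π1 π2 : ℝ) : ℝ := (1 - θ) * (π2 - π1)

/-- The Gaussian-approximation function
`f(s) = E[π₁ e^{sμ₁+√s W₁} / (π₁ e^{sμ₁+√s W₁} + π₂ e^{sμ₂+√s W₂})] − π₁`,
where `μ₁ = 1/(2π₁)`, `μ₂ = −(1+π₂)/(2π₂²)`, `W₁ ∼ N(0, 1/π₁)` (realized as `w/√π₁`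
for `w` standard Gaussian) and `W₂ = −(π₁/π₂)·W₁`. -/
noncomputable def gfun (π1 π2 : ℝ) (s : ℝ) : ℝ :=
  (∫ w : ℝ,
      (π1 * Real.exp (s * (1 / (2 * π1)) + Real.sqrt s * (w / Real.sqrt π1))) /
        (π1 * Real.exp (s * (1 / (2 * π1)) + Real.sqrt s * (w / Real.sqrt π1)) +
          π2 * Real.exp (s * (-(1 + π2) / (2 * π2 ^ 2)) +
            Real.sqrt s * (-(π1 / π2) * (w / Real.sqrt π1))))
    ∂(ProbabilityTheory.gaussianReal 0 1)) - π1

/-- `S = E[(π₁Z₁ + π₂Z₂ − 1)²·(π₁Z₁/(π₁Z₁ + π₂Z₂) − π₁)]` under the conditioning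
`σ_ρ = 1`. -/
noncomputable def Sterm (d : ℕ) (θ Δ : ℝ) (n : ℕ) : ℝ :=
  expect1 d θ Δ (n + 1) (fun A =>
    (pst θ Δ 0 * Z1fun d θ Δ n A + pst θ Δ 1 * Z2fun d θ Δ n A - 1) ^ 2 *
      (pst θ Δ 0 * Z1fun d θ Δ n A /
          (pst θ Δ 0 * Z1fun d θ Δ n A + pst θ Δ 1 * Z2fun d θ Δ n A) -
        pst θ Δ 0))

/-- Assemble a root spin and the configurations of the child subtrees. -/
def glueConf {d n : ℕ} (x : Fin 2 × (Fin d → Conf d n)) : Conf d (n + 1) := fun k =>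
  Fin.cases (motive := fun k : Fin (n + 2) => Vert d k → Fin 2) (fun _ => x.1)
    (fun k (v : Fin (k + 1) → Fin d) => x.2 (v 0) k (Fin.tail v)) k

/-- A configuration is a root spin together with the configurations of the child subtrees. -/
def confEquiv (d n : ℕ) : (Fin 2 × (Fin d → Conf d n)) ≃ Conf d (n + 1) where
  toFun := glueConf
  invFun σ := (root σ, fun j k v => σ k.succ (Fin.cons j v : Fin (k + 1) → Fin d))
  left_inv x := by
    refine Prod.ext rfl ?_
    funext j k v
    rfl
  right_inv σ := by
    funext k
    induction k using Fin.cases with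
    | zero =>
      funext v
      exact congrArg (σ 0) (funext fun i => i.elim0)
    | succ k =>
      funext v
      exact congrArg (σ k.succ) (Fin.cons_self_tail (α := fun _ => Fin d) v)

lemma root_glueConf {d n : ℕ} (x : Fin 2 × (Fin d → Conf d n)) : root (glueConf x) = x.1 := rfl

lemma restrictChild_top_glueConf {d n : ℕ} (x : Fin 2 × (Fin d → Conf d n)) (j : Fin d) :
    restrictChild j (top (glueConf x)) = top (x.2 j) := rfl

lemma restrictChild_ext {d n : ℕ} {A B : LConf d (n + 1)}
    (h : ∀ j, restrictChild j A = restrictChild j B) : A = B := by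
  funext v
  have := congrFun (h (v 0)) (Fin.tail v)
  simpa [restrictChild, Fin.cons_self_tail] using this

/-- A level-`(n+1)` configuration is a family of level-`n` configurations of the child subtrees. -/
def levelEquiv (d n : ℕ) : LConf d (n + 1) ≃ (Fin d → LConf d n) where
  toFun A j := restrictChild j A
  invFun a v := a (v 0) (Fin.tail v)
  left_inv _ := restrictChild_ext fun _ => rfl
  right_inv _ := rfl

lemma prod_vert_succ {d k : ℕ} (f : Vert d (k + 1) → ℝ) :
    ∏ v, f v = ∏ j : Fin d, ∏ w : Vert d k, f (Fin.cons j w) := by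
  rw [← (Fin.consEquiv (fun _ : Fin (k + 1) => Fin d)).prod_comp, Fintype.prod_prod_type]
  rfl

lemma confProb_glueConf {d n : ℕ} {θ Δ : ℝ} (hπ : ∀ i, pst θ Δ i ≠ 0)
    (x : Fin 2 × (Fin d → Conf d n)) :
    confProb d θ Δ (n + 1) (glueConf x) = pst θ Δ x.1 *
      ∏ j, (Mmat θ Δ x.1 (root (x.2 j)) * (confProb d θ Δ n (x.2 j) / pst θ Δ (root (x.2 j)))) := by
  have h : ∀ j, confProb d θ Δ n (x.2 j) / pst θ Δ (root (x.2 j)) =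
      ∏ k : Fin n, ∏ v : Vert d (k + 1),
        Mmat θ Δ (x.2 j k.castSucc (v ∘ Fin.castSucc)) (x.2 j k.succ v) := fun j => by
    rw [confProb, mul_div_cancel_left₀ _ (hπ _)]
  simp only [h]
  rw [confProb, root_glueConf, Fin.prod_univ_succ, Finset.prod_mul_distrib]
  congr 2
  · rw [prod_vert_succ]
    refine Finset.prod_congr rfl fun j _ => ?_
    refine (Fintype.prod_unique (ι := Fin 0 → Fin d) _).trans ?_
    refine congrArg (Mmat θ Δ x.1) ?_
    exact congrArg (x.2 j 0) (funext fun i => i.elim0)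
  · rw [Finset.prod_comm]
    refine Finset.prod_congr rfl fun k _ => ?_
    exact prod_vert_succ (d := d) (k := k + 1) _

lemma jointProb_succ {d n : ℕ} {θ Δ : ℝ} (hπ : ∀ i, pst θ Δ i ≠ 0) (i : Fin 2)
    (A : LConf d (n + 1)) :
    jointProb d θ Δ (n + 1) i A = pst θ Δ i *
      ∏ j, ∑ k, Mmat θ Δ i k * (jointProb d θ Δ n k (restrictChild j A) / pst θ Δ k) := by
  have hin : ∀ j, ∑ k, Mmat θ Δ i k * (jointProb d θ Δ n k (restrictChild j A) / pst θ Δ k) =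
      ∑ τ : Conf d n, if top τ = restrictChild j A then
        Mmat θ Δ i (root τ) * (confProb d θ Δ n τ / pst θ Δ (root τ)) else 0 := fun j => by
    simp only [jointProb, Finset.sum_div, Finset.mul_sum]
    rw [Finset.sum_comm]
    refine Finset.sum_congr rfl fun τ _ => ?_
    rw [Finset.sum_eq_single (root τ)]
    · by_cases h : top τ = restrictChild j A <;> simp [h]
    · intro b _ hb
      simp [hb.symm]
    · simp
  simp only [hin]
  rw [Finset.prod_univ_sum, Fintype.piFinset_univ, Finset.mul_sum, jointProb,
    ← (confEquiv d n).sum_comp, Fintype.sum_prod_type, Finset.sum_eq_single i]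
  · refine Finset.sum_congr rfl fun τ _ => ?_
    change (if root (glueConf (i, τ)) = i ∧ top (glueConf (i, τ)) = A then
      confProb d θ Δ (n + 1) (glueConf (i, τ)) else 0) = _
    rw [confProb_glueConf hπ, root_glueConf]
    by_cases h : ∀ j, top (τ j) = restrictChild j A
    · have : top (glueConf (i, τ)) = A := restrictChild_ext h
      simp [this, h]
    · have h' : top (glueConf (i, τ)) ≠ A := fun e => h fun j => by
        rw [← e, restrictChild_top_glueConf]
      obtain ⟨j, hj⟩ := not_forall.1 h
      rw [if_neg (fun e => h' e.2), Finset.prod_eq_zero (Finset.mem_univ j) (if_neg hj), mul_zero]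
  · intro b _ hb
    refine Finset.sum_eq_zero fun τ _ => if_neg fun e => hb e.1
  · simp

lemma levelProb_eq_add (d : ℕ) (θ Δ : ℝ) (n : ℕ) (A : LConf d n) :
    levelProb d θ Δ n A = jointProb d θ Δ n 0 A + jointProb d θ Δ n 1 A := by
  simp only [levelProb, jointProb, ← Finset.sum_add_distrib]
  refine Finset.sum_congr rfl fun σ _ => ?_
  have : root σ = 0 ∨ root σ = 1 := by
    generalize root σ = r
    fin_cases r <;> simp
  rcases this with h | h <;> simp [h]

lemma jointProb_nonneg {d : ℕ} {θ Δ : ℝ} (hπ : ∀ i, 0 < pst θ Δ i)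
    (hM : ∀ i j, 0 < Mmat θ Δ i j) (n : ℕ) (i : Fin 2) (A : LConf d n) :
    0 ≤ jointProb d θ Δ n i A := by
  refine Finset.sum_nonneg fun σ _ => ?_
  split_ifs
  · exact mul_nonneg (hπ _).le (Finset.prod_nonneg fun k _ => Finset.prod_nonneg fun v _ =>
      (hM _ _).le)
  · exact le_rfl

lemma sum_jointProb_zero (d : ℕ) (θ Δ : ℝ) (i : Fin 2) :
    ∑ A, jointProb d θ Δ 0 i A = pst θ Δ i := by
  have key : ∀ σ : Conf d 0, σ = fun _ _ => root σ := fun σ => by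
    funext k
    obtain rfl : k = 0 := Fin.fin_one_eq_zero k
    funext v
    exact congrArg (σ 0) (funext fun i => i.elim0)
  simp only [jointProb]
  rw [Finset.sum_comm, Finset.sum_eq_single (fun _ _ => i)]
  · rw [Finset.sum_eq_single (fun _ => i)]
    · rw [if_pos ⟨rfl, rfl⟩]
      simp [confProb, root]
    · intro B _ hB
      exact if_neg fun e => hB e.2.symm
    · simp
  · intro σ _ hσ
    refine Finset.sum_eq_zero fun A _ => if_neg fun e => hσ ?_
    rw [key σ, e.1]
  · simp

lemma sum_jointProb {d : ℕ} {θ Δ : ℝ} (hπ : ∀ i, pst θ Δ i ≠ 0) (n : ℕ) (i : Fin 2) :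
    ∑ A, jointProb d θ Δ n i A = pst θ Δ i := by
  induction n generalizing i with
  | zero => exact sum_jointProb_zero d θ Δ i
  | succ n ih =>
    simp only [jointProb_succ hπ]
    rw [← Finset.mul_sum]
    refine (congrArg (pst θ Δ i * ·) ((levelEquiv d n).sum_comp (fun a => ∏ j, ∑ k, Mmat θ Δ i k *
      (jointProb d θ Δ n k (a j) / pst θ Δ k)))).trans ?_
    rw [← Fintype.piFinset_univ, ← Finset.prod_univ_sum (fun _ => Finset.univ)
      (fun (_ : Fin d) a => ∑ k, Mmat θ Δ i k * (jointProb d θ Δ n k a / pst θ Δ k))]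
    have : ∑ a, ∑ k, Mmat θ Δ i k * (jointProb d θ Δ n k a / pst θ Δ k) = 1 := by
      rw [Finset.sum_comm]
      simp only [← Finset.mul_sum, ← Finset.sum_div, ih, div_self (hπ _), mul_one]
      fin_cases i <;> simp [Mmat, Fin.sum_univ_two] <;> ring
    simp only [this, Finset.prod_const_one, mul_one]

/-- Expectation of `F` under the `d`-fold product of the weights `p`. -/
def iidSum {Ω : Type} [Fintype Ω] (d : ℕ) (p : Ω → ℝ) (F : (Fin d → Ω) → ℝ) : ℝ :=
  ∑ a : Fin d → Ω, (∏ j, p (a j)) * F a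

section iidSum

variable {Ω : Type} [Fintype Ω]

lemma iidSum_prod (d : ℕ) (p g : Ω → ℝ) :
    iidSum d p (fun a => ∏ j, g (a j)) = (∑ ω, p ω * g ω) ^ d := by
  simp only [iidSum, ← Finset.prod_mul_distrib]
  rw [← Fintype.piFinset_univ, ← Finset.prod_univ_sum (fun _ => Finset.univ)
    (fun (_ : Fin d) ω => p ω * g ω)]
  simp

lemma iidSum_add (d : ℕ) (p : Ω → ℝ) (F G : (Fin d → Ω) → ℝ) :
    iidSum d p (fun a => F a + G a) = iidSum d p F + iidSum d p G := by
  simp only [iidSum, mul_add, Finset.sum_add_distrib]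

lemma iidSum_const_mul (d : ℕ) (p : Ω → ℝ) (c : ℝ) (F : (Fin d → Ω) → ℝ) :
    iidSum d p (fun a => c * F a) = c * iidSum d p F := by
  simp only [iidSum, Finset.mul_sum]
  exact Finset.sum_congr rfl fun a _ => by ring

lemma iidSum_mono {d : ℕ} {p : Ω → ℝ} (hp : ∀ ω, 0 ≤ p ω) {F G : (Fin d → Ω) → ℝ}
    (h : ∀ a, F a ≤ G a) : iidSum d p F ≤ iidSum d p G :=
  Finset.sum_le_sum fun a _ =>
    mul_le_mul_of_nonneg_left (h a) (Finset.prod_nonneg fun _ _ => hp _)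

lemma iidSum_prod_mul (d : ℕ) (p g : Ω → ℝ) (F : (Fin d → Ω) → ℝ) :
    iidSum d p (fun a => (∏ j, g (a j)) * F a) = iidSum d (fun ω => p ω * g ω) F := by
  simp only [iidSum, Finset.prod_mul_distrib, mul_assoc]

lemma iidSum_succ (d : ℕ) (p : Ω → ℝ) (F : (Fin (d + 1) → Ω) → ℝ) :
    iidSum (d + 1) p F = ∑ ω, p ω * iidSum d p (fun a => F (Fin.cons ω a)) := by
  rw [iidSum, ← (Fin.consEquiv (fun _ : Fin (d + 1) => Ω)).sum_comp, Fintype.sum_prod_type]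
  refine Finset.sum_congr rfl fun ω _ => ?_
  rw [iidSum, Finset.mul_sum]
  refine Finset.sum_congr rfl fun a _ => ?_
  simp [Fin.consEquiv, Fin.prod_univ_succ, mul_assoc]

lemma iidSum_one {d : ℕ} {p : Ω → ℝ} (hp : ∑ ω, p ω = 1) : iidSum d p (fun _ => 1) = 1 := by
  simpa [hp] using iidSum_prod d p (fun _ => 1)

lemma iidSum_sum {d : ℕ} {p : Ω → ℝ} (hp : ∑ ω, p ω = 1) (h : Ω → ℝ) :
    iidSum d p (fun a => ∑ j, h (a j)) = d * ∑ ω, p ω * h ω := by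
  induction d with
  | zero => simp [iidSum]
  | succ d ih =>
    simp only [iidSum_succ, Fin.sum_univ_succ, Fin.cons_zero, Fin.cons_succ]
    simp only [iidSum_add, ih]
    have : ∀ ω, iidSum d p (fun _ => h ω) = h ω := fun ω => by
      simpa [iidSum_one hp] using iidSum_const_mul d p (h ω) (fun _ => 1)
    simp only [this, mul_add, Finset.sum_add_distrib, ← Finset.sum_mul, hp]
    push_cast
    ring

lemma iidSum_sum_sq {d : ℕ} {p : Ω → ℝ} (hp : ∑ ω, p ω = 1) (h : Ω → ℝ) :
    iidSum d p (fun a => (∑ j, h (a j)) ^ 2) =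
      d * ∑ ω, p ω * h ω ^ 2 + d * (d - 1) * (∑ ω, p ω * h ω) ^ 2 := by
  induction d with
  | zero => simp [iidSum]
  | succ d ih =>
    simp only [iidSum_succ, Fin.sum_univ_succ, Fin.cons_zero, Fin.cons_succ]
    have hexp : ∀ ω, iidSum d p (fun a => (h ω + ∑ j, h (a j)) ^ 2) =
        h ω ^ 2 + 2 * h ω * (d * ∑ ω, p ω * h ω) +
          (d * ∑ ω, p ω * h ω ^ 2 + d * (d - 1) * (∑ ω, p ω * h ω) ^ 2) := fun ω => by
      rw [← ih, ← iidSum_sum hp, ← iidSum_const_mul]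
      have h1 : h ω ^ 2 = iidSum d p (fun _ => h ω ^ 2) := by
        simpa [iidSum_one hp] using (iidSum_const_mul d p (h ω ^ 2) (fun _ => 1)).symm
      rw [h1, ← iidSum_add, ← iidSum_add]
      exact congrArg _ (funext fun a => by ring)
    have hlin : ∀ c : ℝ, ∑ ω, p ω * (2 * h ω * c) = 2 * c * ∑ ω, p ω * h ω := fun c => by
      rw [Finset.mul_sum]
      exact Finset.sum_congr rfl fun ω _ => by ring
    simp only [hexp, mul_add (p _), Finset.sum_add_distrib, ← Finset.sum_mul, hp, hlin]
    push_cast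
    ring

end iidSum

lemma exists_one_add_pow_bound (K : ℝ) (d : ℕ) : ∃ C : ℝ, 0 ≤ C ∧ ∀ w : ℝ, |w| ≤ K →
    |(1 + w) ^ d - 1 - d * w| ≤ C * w ^ 2 ∧
    |(1 + w) ^ d - 1 - d * w - d * (d - 1) / 2 * w ^ 2| ≤ C * |w| ^ 3 := by
  induction d with
  | zero => exact ⟨0, le_rfl, fun w _ => by simp⟩
  | succ d ih =>
    obtain ⟨C, hC, h⟩ := ih
    refine ⟨(1 + |K|) * C + d + d ^ 2, by positivity, fun w hw => ?_⟩
    obtain ⟨h1, h2⟩ := h w hw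
    have hb : |1 + w| ≤ 1 + |K| := (abs_add_le _ _).trans (by
      rw [abs_one]; linarith [le_abs_self K])
    have hd : (0 : ℝ) ≤ d := d.cast_nonneg
    constructor
    · have e : (1 + w) ^ (d + 1) - 1 - ((d + 1 : ℕ) : ℝ) * w =
          (1 + w) * ((1 + w) ^ d - 1 - d * w) + d * w ^ 2 := by push_cast; ring
      rw [e]
      refine (abs_add_le _ _).trans ?_
      rw [abs_mul, abs_of_nonneg (by positivity : 0 ≤ (d : ℝ) * w ^ 2)]
      have := mul_le_mul hb h1 (abs_nonneg _) (by positivity)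
      nlinarith [mul_nonneg (sq_nonneg (d : ℝ)) (sq_nonneg w)]
    · have e : (1 + w) ^ (d + 1) - 1 - ((d + 1 : ℕ) : ℝ) * w
            - ((d + 1 : ℕ) : ℝ) * (((d + 1 : ℕ) : ℝ) - 1) / 2 * w ^ 2 =
          (1 + w) * ((1 + w) ^ d - 1 - d * w - d * (d - 1) / 2 * w ^ 2)
            + d * (d - 1) / 2 * w ^ 3 := by push_cast; ring
      rw [e]
      refine (abs_add_le _ _).trans ?_
      rw [abs_mul, abs_mul (_ / 2), abs_pow]
      have h3 : |(d : ℝ) * (d - 1) / 2| ≤ d + d ^ 2 := by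
        rw [abs_le]; constructor <;> nlinarith
      have := mul_le_mul hb h2 (abs_nonneg _) (by positivity)
      have := mul_le_mul_of_nonneg_right h3 (pow_nonneg (abs_nonneg w) 3)
      nlinarith

lemma exists_monomial_bound (A : ℝ) (m k : ℕ) : ∃ C : ℝ, 0 ≤ C ∧ ∀ a b t : ℝ,
    |a| ≤ A → |b| ≤ A → |t| ≤ 1 →
    |(1 + a * t) ^ m * (1 - b * t) ^ k - 1 - (m * a - k * b) * t| ≤ C * t ^ 2 := by
  obtain ⟨C₁, hC₁, h₁⟩ := exists_one_add_pow_bound |A| m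
  obtain ⟨C₂, hC₂, h₂⟩ := exists_one_add_pow_bound |A| k
  refine ⟨C₁ * A ^ 2 * (1 + |A|) ^ k + (1 + m * |A|) * (C₂ * A ^ 2) + m * k * A ^ 2,
    by positivity, fun a b t ha hb ht => ?_⟩
  have hA : 0 ≤ A := (abs_nonneg a).trans ha
  have habs : |A| = A := abs_of_nonneg hA
  have hle : ∀ c : ℝ, |c| ≤ A → |c * t| ≤ A := fun c hc => by
    rw [abs_mul]
    exact (mul_le_mul hc ht (abs_nonneg _) hA).trans (mul_one A).le
  have hsq : ∀ c : ℝ, |c| ≤ A → (c * t) ^ 2 ≤ A ^ 2 * t ^ 2 := fun c hc => by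
    rw [mul_pow]
    exact mul_le_mul_of_nonneg_right (sq_le_sq.2 (by rwa [habs])) (sq_nonneg t)
  have r₁ := (h₁ (a * t) (by rw [habs]; exact hle a ha)).1
  have r₂ := (h₂ (-(b * t)) (by rw [habs, abs_neg]; exact hle b hb)).1
  rw [neg_sq] at r₂
  set R₁ := (1 + a * t) ^ m - 1 - m * (a * t) with hR₁
  set R₂ := (1 + -(b * t)) ^ k - 1 - k * -(b * t) with hR₂
  have e : (1 + a * t) ^ m * (1 - b * t) ^ k - 1 - (m * a - k * b) * t =
      R₁ * (1 - b * t) ^ k + (1 + m * (a * t)) * R₂ + m * k * -((a * t) * (b * t)) := by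
    rw [hR₁, hR₂, ← sub_eq_add_neg]; ring
  have b₁ : |R₁ * (1 - b * t) ^ k| ≤ C₁ * (A ^ 2 * t ^ 2) * (1 + |A|) ^ k := by
    rw [abs_mul, abs_pow]
    refine mul_le_mul (r₁.trans (mul_le_mul_of_nonneg_left (hsq a ha) hC₁))
      (pow_le_pow_left₀ (abs_nonneg _) ?_ _) (by positivity) (by positivity)
    refine (abs_sub _ _).trans ?_
    rw [abs_one, habs]
    linarith [hle b hb]
  have b₂ : |(1 + m * (a * t)) * R₂| ≤ (1 + m * |A|) * (C₂ * (A ^ 2 * t ^ 2)) := by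
    rw [abs_mul]
    refine mul_le_mul ?_ (r₂.trans (mul_le_mul_of_nonneg_left (hsq b hb) hC₂))
      (abs_nonneg _) (by positivity)
    refine (abs_add_le _ _).trans ?_
    rw [abs_one, abs_mul, habs, Nat.abs_cast]
    gcongr
    exact hle a ha
  have b₃ : |m * k * -((a * t) * (b * t))| ≤ m * k * (A ^ 2 * t ^ 2) := by
    rw [abs_mul, abs_neg, abs_of_nonneg (by positivity : (0 : ℝ) ≤ m * k)]
    refine mul_le_mul_of_nonneg_left ?_ (by positivity)
    rw [abs_le]
    constructor <;> nlinarith [hsq a ha, hsq b hb, sq_nonneg (a * t + b * t),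
      sq_nonneg (a * t - b * t)]
  rw [e]
  refine ((abs_add_le _ _).trans (add_le_add_left (abs_add_le _ _) _)).trans ?_
  linarith

/-- Evaluate a polynomial in two variables. -/
noncomputable def evalPair (G : MvPolynomial (Fin 2) ℝ) (x y : ℝ) : ℝ := MvPolynomial.eval ![x, y] G

lemma evalPair_monomial (u : Fin 2 →₀ ℕ) (c x y : ℝ) :
    evalPair (MvPolynomial.monomial u c) x y = c * (x ^ u 0 * y ^ u 1) := by
  rw [evalPair, MvPolynomial.eval_monomial, Finsupp.prod_fintype _ _ (by simp)]
  simp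

lemma evalPair_add (G H : MvPolynomial (Fin 2) ℝ) (x y : ℝ) :
    evalPair (G + H) x y = evalPair G x y + evalPair H x y := by
  simp [evalPair]

/-- For a polynomial in the two products `∏ (1 + a D)` and `∏ (1 - b D)` of centered i.i.d.
variables, the expectation is determined by one- and two-variable interactions, up to a power of
the variance. -/
lemma iidSum_evalPair_expansion (d : ℕ) (A : ℝ) (G : MvPolynomial (Fin 2) ℝ) :
    ∃ C : ℝ, 0 ≤ C ∧ ∀ (Ω : Type) [Fintype Ω] (p D : Ω → ℝ) (a b : ℝ),
      (∀ ω, 0 ≤ p ω) → ∑ ω, p ω = 1 → ∑ ω, p ω * D ω = 0 → (∀ ω, |D ω| ≤ 1) →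
      |a| ≤ A → |b| ≤ A →
      |iidSum d p (fun ω => evalPair G (∏ j, (1 + a * D (ω j))) (∏ j, (1 - b * D (ω j))))
          - evalPair G 1 1
          - d * ∑ ω, p ω * (evalPair G (1 + a * D ω) (1 - b * D ω) - evalPair G 1 1)|
        ≤ C * (∑ ω, p ω * D ω ^ 2) ^ 2 ∧
      |iidSum d p (fun ω => evalPair G (∏ j, (1 + a * D (ω j))) (∏ j, (1 - b * D (ω j))))
          - evalPair G 1 1
          - d * ∑ ω, p ω * (evalPair G (1 + a * D ω) (1 - b * D ω) - evalPair G 1 1)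
          - d * (d - 1) / 2 * ∑ ω, p ω * ∑ η, p η *
            (evalPair G ((1 + a * D ω) * (1 + a * D η)) ((1 - b * D ω) * (1 - b * D η))
              - evalPair G (1 + a * D ω) (1 - b * D ω)
              - evalPair G (1 + a * D η) (1 - b * D η) + evalPair G 1 1)|
        ≤ C * (∑ ω, p ω * D ω ^ 2) ^ 3 := by
  induction G using MvPolynomial.induction_on' with
  | monomial u c =>
    obtain ⟨C₁, hC₁, h₁⟩ := exists_monomial_bound A (u 0) (u 1)
    obtain ⟨C₂, hC₂, h₂⟩ := exists_one_add_pow_bound C₁ d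
    refine ⟨|c| * C₂ * (C₁ ^ 2 + C₁ ^ 3), by positivity,
      fun Ω _ p D a b hp hp1 hD0 hD1 ha hb => ?_⟩
    simp only [evalPair_monomial, one_pow, mul_one]
    set g : Ω → ℝ := fun ω => (1 + a * D ω) ^ u 0 * (1 - b * D ω) ^ u 1 with hg
    set z := ∑ ω, p ω * D ω ^ 2 with hz
    set w := ∑ ω, p ω * (g ω - 1) with hw
    have hz0 : 0 ≤ z := Finset.sum_nonneg fun ω _ => mul_nonneg (hp ω) (sq_nonneg _)
    have hz1 : z ≤ 1 := by
      rw [← hp1]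
      refine Finset.sum_le_sum fun ω _ => ?_
      have := (sq_le_one_iff_abs_le_one _).2 (hD1 ω)
      nlinarith [hp ω]
    have hwz : |w| ≤ C₁ * z := by
      have e : w = ∑ ω, p ω * (g ω - 1 - (u 0 * a - u 1 * b) * D ω) := by
        have : ∑ ω, p ω * ((u 0 * a - u 1 * b) * D ω) = 0 := by
          have : ∀ ω, p ω * ((u 0 * a - u 1 * b) * D ω) = (u 0 * a - u 1 * b) * (p ω * D ω) :=
            fun ω => by ring
          simp only [this, ← Finset.mul_sum, hD0, mul_zero]
        simp only [mul_sub (p _) (_ - 1), Finset.sum_sub_distrib, this, sub_zero, hw]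
      rw [e, hz, Finset.mul_sum]
      refine (Finset.abs_sum_le_sum_abs _ _).trans (Finset.sum_le_sum fun ω _ => ?_)
      rw [abs_mul, abs_of_nonneg (hp ω)]
      have := mul_le_mul_of_nonneg_left (h₁ a b (D ω) ha hb (hD1 ω)) (hp ω)
      linarith
    have hw1 : ∑ ω, p ω * g ω = 1 + w := by
      simp only [hw, mul_sub, mul_one, Finset.sum_sub_distrib, hp1]
      ring
    have hI : iidSum d p (fun ω => c * ((∏ j, (1 + a * D (ω j))) ^ u 0 *
        (∏ j, (1 - b * D (ω j))) ^ u 1)) = c * (1 + w) ^ d := by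
      rw [iidSum_const_mul, ← hw1, ← iidSum_prod]
      simp only [hg, Finset.prod_mul_distrib, Finset.prod_pow]
    have hL : ∑ ω, p ω * (c * ((1 + a * D ω) ^ u 0 * (1 - b * D ω) ^ u 1) - c) = c * w := by
      rw [hw, Finset.mul_sum]
      exact Finset.sum_congr rfl fun ω _ => by simp only [hg]; ring
    have hQ : ∑ ω, p ω * ∑ η, p η *
        (c * (((1 + a * D ω) * (1 + a * D η)) ^ u 0 * ((1 - b * D ω) * (1 - b * D η)) ^ u 1)
          - c * ((1 + a * D ω) ^ u 0 * (1 - b * D ω) ^ u 1)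
          - c * ((1 + a * D η) ^ u 0 * (1 - b * D η) ^ u 1) + c) = c * w ^ 2 := by
      have : ∀ ω η, p η *
        (c * (((1 + a * D ω) * (1 + a * D η)) ^ u 0 * ((1 - b * D ω) * (1 - b * D η)) ^ u 1)
          - c * ((1 + a * D ω) ^ u 0 * (1 - b * D ω) ^ u 1)
          - c * ((1 + a * D η) ^ u 0 * (1 - b * D η) ^ u 1) + c) =
          (c * (g ω - 1)) * (p η * (g η - 1)) := fun ω η => by simp only [hg, mul_pow]; ring
      simp only [this, ← Finset.mul_sum, ← hw]
      rw [sq, ← mul_assoc, mul_comm c w, hw, Finset.sum_mul, Finset.sum_mul]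
      exact Finset.sum_congr rfl fun ω _ => by ring
    rw [hI, hL, hQ]
    obtain ⟨b₁, b₂⟩ := h₂ w (hwz.trans (mul_le_of_le_one_right hC₁ hz1))
    have hw2 : w ^ 2 ≤ C₁ ^ 2 * z ^ 2 := by
      rw [← sq_abs, ← mul_pow]; exact pow_le_pow_left₀ (abs_nonneg w) hwz 2
    have hw3 : |w| ^ 3 ≤ C₁ ^ 3 * z ^ 3 := by
      rw [← mul_pow]; exact pow_le_pow_left₀ (abs_nonneg w) hwz 3
    constructor
    · have e : c * (1 + w) ^ d - c - d * (c * w) = c * ((1 + w) ^ d - 1 - d * w) := by ring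
      rw [e, abs_mul]
      calc _ ≤ |c| * (C₂ * (C₁ ^ 2 * z ^ 2)) := by
            gcongr; exact b₁.trans (mul_le_mul_of_nonneg_left hw2 hC₂)
        _ ≤ |c| * (C₂ * (C₁ ^ 2 * z ^ 2)) + |c| * (C₂ * (C₁ ^ 3 * z ^ 2)) :=
            le_add_of_nonneg_right (by positivity)
        _ = _ := by ring
    · have e : c * (1 + w) ^ d - c - d * (c * w) - d * (d - 1) / 2 * (c * w ^ 2) =
          c * ((1 + w) ^ d - 1 - d * w - d * (d - 1) / 2 * w ^ 2) := by ring
      rw [e, abs_mul]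
      calc _ ≤ |c| * (C₂ * (C₁ ^ 3 * z ^ 3)) := by
            gcongr; exact b₂.trans (mul_le_mul_of_nonneg_left hw3 hC₂)
        _ ≤ |c| * (C₂ * (C₁ ^ 3 * z ^ 3)) + |c| * (C₂ * (C₁ ^ 2 * z ^ 3)) :=
            le_add_of_nonneg_right (by positivity)
        _ = _ := by ring
  | add G H hG hH =>
    obtain ⟨C₁, hC₁, h₁⟩ := hG
    obtain ⟨C₂, hC₂, h₂⟩ := hH
    refine ⟨C₁ + C₂, by positivity, fun Ω _ p D a b hp hp1 hD0 hD1 ha hb => ?_⟩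
    obtain ⟨g₁, g₂⟩ := h₁ Ω p D a b hp hp1 hD0 hD1 ha hb
    obtain ⟨k₁, k₂⟩ := h₂ Ω p D a b hp hp1 hD0 hD1 ha hb
    simp only [evalPair_add, iidSum_add]
    constructor
    · refine le_trans (le_of_eq (congrArg _ ?_)) (((abs_add_le _ _).trans
        (add_le_add g₁ k₁)).trans (add_mul _ _ _).ge)
      simp only [mul_sub, mul_add, Finset.sum_sub_distrib, Finset.sum_add_distrib]
      ring
    · refine le_trans (le_of_eq (congrArg _ ?_)) (((abs_add_le _ _).trans
        (add_le_add g₂ k₂)).trans (add_mul _ _ _).ge)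
      simp only [mul_sub, mul_add, Finset.sum_sub_distrib, Finset.sum_add_distrib]
      ring

section Step

variable {Ω : Type} [Fintype Ω] {d : ℕ}

/-- The product `∏ (1 + (θ/π₁) D_j)`. -/
noncomputable def Zone (π1 θ : ℝ) (D : Ω → ℝ) (a : Fin d → Ω) : ℝ := ∏ j, (1 + θ / π1 * D (a j))

/-- The product `∏ (1 - (θ/π₂) D_j)`. -/
noncomputable def Ztwo (π2 θ : ℝ) (D : Ω → ℝ) (a : Fin d → Ω) : ℝ := ∏ j, (1 - θ / π2 * D (a j))

/-- The density `π₁ Z₁ + π₂ Z₂` of the joint law of the subtrees relative to the product law. -/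
noncomputable def Wmix (π1 π2 θ : ℝ) (D : Ω → ℝ) (a : Fin d → Ω) : ℝ :=
  π1 * Zone π1 θ D a + π2 * Ztwo π2 θ D a

/-- The deviation of the posterior of the root from `π₁`, in terms of those of its children. -/
noncomputable def dev (π1 π2 θ : ℝ) (D : Ω → ℝ) (a : Fin d → Ω) : ℝ :=
  π1 * Zone π1 θ D a / Wmix π1 π2 θ D a - π1

/-- `D` is a centered posterior deviation under the probability weights `p`. -/
structure IsDeviation (π1 π2 θ : ℝ) (p D : Ω → ℝ) : Prop where
  nonneg : ∀ ω, 0 ≤ p ω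
  sum_one : ∑ ω, p ω = 1
  mean_zero : ∑ ω, p ω * D ω = 0
  lower : ∀ ω, -π1 ≤ D ω
  upper : ∀ ω, D ω ≤ π2
  pos_one : ∀ ω, 0 < 1 + θ / π1 * D ω
  pos_two : ∀ ω, 0 < 1 - θ / π2 * D ω

variable {π1 π2 θ : ℝ} {p D : Ω → ℝ}

namespace IsDeviation

lemma abs_le_one (h : IsDeviation π1 π2 θ p D) (h1 : 0 < π1) (h2 : 0 < π2) (hs : π1 + π2 = 1)
    (ω : Ω) : |D ω| ≤ 1 :=
  abs_le.2 ⟨by linarith [h.lower ω], by linarith [h.upper ω]⟩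

lemma second_moment_nonneg (h : IsDeviation π1 π2 θ p D) : 0 ≤ ∑ ω, p ω * D ω ^ 2 :=
  Finset.sum_nonneg fun ω _ => mul_nonneg (h.nonneg ω) (sq_nonneg _)

lemma second_moment_le (h : IsDeviation π1 π2 θ p D) : ∑ ω, p ω * D ω ^ 2 ≤ π1 * π2 := by
  have key : ∑ ω, p ω * (D ω ^ 2 - (π2 - π1) * D ω - π1 * π2) ≤ 0 :=
    Finset.sum_nonpos fun ω _ => mul_nonpos_of_nonneg_of_nonpos (h.nonneg ω) (by
      nlinarith [mul_nonneg (sub_nonneg.2 (h.lower ω)) (sub_nonneg.2 (h.upper ω))])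
  have e : ∑ ω, p ω * (D ω ^ 2 - (π2 - π1) * D ω - π1 * π2) =
      ∑ ω, p ω * D ω ^ 2 - (π2 - π1) * ∑ ω, p ω * D ω - (∑ ω, p ω) * (π1 * π2) := by
    rw [Finset.mul_sum, Finset.sum_mul, ← Finset.sum_sub_distrib, ← Finset.sum_sub_distrib]
    exact Finset.sum_congr rfl fun ω _ => by ring
  rw [e, h.mean_zero, h.sum_one] at key
  linarith

lemma fourth_moment_le (h : IsDeviation π1 π2 θ p D) (h1 : 0 < π1) (h2 : 0 < π2)
    (hs : π1 + π2 = 1) : ∑ ω, p ω * D ω ^ 4 ≤ ∑ ω, p ω * D ω ^ 2 := by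
  refine Finset.sum_le_sum fun ω _ => mul_le_mul_of_nonneg_left ?_ (h.nonneg ω)
  have := (sq_le_one_iff_abs_le_one _).2 (h.abs_le_one h1 h2 hs ω)
  nlinarith [sq_nonneg (D ω)]

lemma Zone_pos (h : IsDeviation π1 π2 θ p D) (a : Fin d → Ω) : 0 < Zone π1 θ D a :=
  Finset.prod_pos fun _ _ => h.pos_one _

lemma Ztwo_pos (h : IsDeviation π1 π2 θ p D) (a : Fin d → Ω) : 0 < Ztwo π2 θ D a :=
  Finset.prod_pos fun _ _ => h.pos_two _

lemma Wmix_pos (h : IsDeviation π1 π2 θ p D) (h1 : 0 < π1) (h2 : 0 < π2) (a : Fin d → Ω) :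
    0 < Wmix π1 π2 θ D a :=
  add_pos (mul_pos h1 (h.Zone_pos a)) (mul_pos h2 (h.Ztwo_pos a))

lemma Wmix_mul_dev (h : IsDeviation π1 π2 θ p D) (h1 : 0 < π1) (h2 : 0 < π2)
    (hs : π1 + π2 = 1) (a : Fin d → Ω) :
    Wmix π1 π2 θ D a * dev π1 π2 θ D a = π1 * π2 * (Zone π1 θ D a - Ztwo π2 θ D a) := by
  have hW := (h.Wmix_pos h1 h2 a).ne'
  rw [dev, mul_sub, mul_div_cancel₀ _ hW, Wmix]
  obtain rfl : π2 = 1 - π1 := by linarith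
  ring

lemma abs_dev_le (h : IsDeviation π1 π2 θ p D) (h1 : 0 < π1) (h2 : 0 < π2)
    (hs : π1 + π2 = 1) (a : Fin d → Ω) : |dev π1 π2 θ D a| ≤ 1 := by
  have hW := h.Wmix_pos h1 h2 a
  have hz : 0 ≤ π1 * Zone π1 θ D a / Wmix π1 π2 θ D a :=
    div_nonneg (mul_pos h1 (h.Zone_pos a)).le hW.le
  have hz' : π1 * Zone π1 θ D a / Wmix π1 π2 θ D a ≤ 1 := by
    rw [div_le_one hW, Wmix]
    linarith [mul_pos h2 (h.Ztwo_pos a)]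
  rw [dev, abs_le]
  constructor <;> linarith

lemma iidSum_Wmix_mul (p D : Ω → ℝ) (F : (Fin d → Ω) → ℝ) :
    iidSum d p (fun a => Wmix π1 π2 θ D a * F a) =
      π1 * iidSum d (fun ω => p ω * (1 + θ / π1 * D ω)) F +
        π2 * iidSum d (fun ω => p ω * (1 - θ / π2 * D ω)) F := by
  rw [← iidSum_prod_mul, ← iidSum_prod_mul, ← iidSum_const_mul, ← iidSum_const_mul, ← iidSum_add]
  exact congrArg _ (funext fun a => by rw [Wmix, Zone, Ztwo]; ring)

lemma le_iidSum_dev_sq (h : IsDeviation π1 π2 θ p D) (h1 : 0 < π1) (h2 : 0 < π2)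
    (hs : π1 + π2 = 1) (c : ℝ) :
    2 * c * (θ * d * ∑ ω, p ω * D ω ^ 2) - c ^ 2 * (d * ∑ ω, p ω * D ω ^ 2 +
        d * (d - 1) * (θ ^ 2 / (π1 * π2)) * (∑ ω, p ω * D ω ^ 2) ^ 2) ≤
      iidSum d p (fun a => Wmix π1 π2 θ D a * dev π1 π2 θ D a ^ 2) := by
  set z := ∑ ω, p ω * D ω ^ 2 with hz
  have hm : ∀ c : ℝ, ∑ ω, p ω * (1 + c * D ω) = 1 := fun c => by
    have : ∀ ω, p ω * (1 + c * D ω) = p ω + c * (p ω * D ω) := fun ω => by ring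
    simp only [this, Finset.sum_add_distrib, ← Finset.mul_sum, h.sum_one, h.mean_zero]
    ring
  have hm1 : ∀ c : ℝ, ∑ ω, p ω * (1 + c * D ω) * D ω = c * z := fun c => by
    have : ∀ ω, p ω * (1 + c * D ω) * D ω = p ω * D ω + c * (p ω * D ω ^ 2) := fun ω => by ring
    simp only [this, Finset.sum_add_distrib, ← Finset.mul_sum, h.mean_zero, zero_add, hz]
  have hm2 : ∀ c : ℝ, ∑ ω, p ω * (1 + c * D ω) * D ω ^ 2 = z + c * ∑ ω, p ω * D ω ^ 3 :=
    fun c => by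
      rw [hz, Finset.mul_sum, ← Finset.sum_add_distrib]
      exact Finset.sum_congr rfl fun ω _ => by ring
  have hneg : (fun ω => p ω * (1 - θ / π2 * D ω)) = fun ω => p ω * (1 + -(θ / π2) * D ω) := by
    funext ω; ring
  have hsq : iidSum d p (fun a => Wmix π1 π2 θ D a * (∑ j, D (a j)) ^ 2) =
      d * z + d * (d - 1) * (θ ^ 2 / (π1 * π2)) * z ^ 2 := by
    rw [iidSum_Wmix_mul, hneg, iidSum_sum_sq (hm _), iidSum_sum_sq (hm _), hm1, hm1, hm2, hm2]
    field_simp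
    linear_combination ((d : ℝ) * z * π1 * π2 + θ ^ 2 * d * (d - 1) * z ^ 2) * hs
  have hcross : iidSum d p (fun a => Wmix π1 π2 θ D a * (dev π1 π2 θ D a * ∑ j, D (a j))) =
      θ * d * z := by
    have : ∀ a : Fin d → Ω, Wmix π1 π2 θ D a * (dev π1 π2 θ D a * ∑ j, D (a j)) =
        π1 * π2 * ((Zone π1 θ D a * ∑ j, D (a j)) + (-1) * (Ztwo π2 θ D a * ∑ j, D (a j))) :=
      fun a => by rw [← mul_assoc, h.Wmix_mul_dev h1 h2 hs]; ring
    simp only [this]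
    rw [iidSum_const_mul, iidSum_add, iidSum_const_mul]
    simp only [Zone, Ztwo]
    rw [iidSum_prod_mul d p (fun ω => 1 + θ / π1 * D ω),
      iidSum_prod_mul d p (fun ω => 1 - θ / π2 * D ω), hneg, iidSum_sum (hm _), iidSum_sum (hm _),
      hm1, hm1]
    field_simp
    linear_combination (θ * d * z) * hs
  have hpos : 0 ≤ iidSum d p (fun a =>
      Wmix π1 π2 θ D a * (dev π1 π2 θ D a - c * ∑ j, D (a j)) ^ 2) :=
    Finset.sum_nonneg fun a _ => mul_nonneg (Finset.prod_nonneg fun _ _ => h.nonneg _)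
      (mul_nonneg (h.Wmix_pos h1 h2 a).le (sq_nonneg _))
  have e : iidSum d p (fun a => Wmix π1 π2 θ D a * (dev π1 π2 θ D a - c * ∑ j, D (a j)) ^ 2) =
      iidSum d p (fun a => Wmix π1 π2 θ D a * dev π1 π2 θ D a ^ 2) +
        ((-2 * c) * (θ * d * z) +
          c ^ 2 * (d * z + d * (d - 1) * (θ ^ 2 / (π1 * π2)) * z ^ 2)) := by
    rw [← hsq, ← hcross, ← iidSum_const_mul, ← iidSum_const_mul, ← iidSum_add, ← iidSum_add]
    exact congrArg _ (funext fun a => by ring)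
  rw [e] at hpos
  linarith

lemma variance_le_four_mul (h : IsDeviation π1 π2 θ p D) (h1 : 0 < π1) (h2 : 0 < π2)
    (hs : π1 + π2 = 1) (hd : 1 / 2 ≤ d * θ ^ 2) (hd' : d * θ ^ 2 ≤ 1) :
    ∑ ω, p ω * D ω ^ 2 ≤ 4 * iidSum d p (fun a => Wmix π1 π2 θ D a * dev π1 π2 θ D a ^ 2) := by
  have key := h.le_iidSum_dev_sq (d := d) h1 h2 hs (θ / 2)
  have hz := h.second_moment_nonneg
  have hz' := h.second_moment_le
  set z := ∑ ω, p ω * D ω ^ 2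
  have hq : z / (π1 * π2) ≤ 1 := (div_le_one (by positivity)).2 hz'
  have hq0 : 0 ≤ z / (π1 * π2) := by positivity
  have e : 2 * (θ / 2) * (θ * d * z) - (θ / 2) ^ 2 *
      (d * z + d * (d - 1) * (θ ^ 2 / (π1 * π2)) * z ^ 2) =
      d * θ ^ 2 * z * (1 - 1 / 4 - (d * θ ^ 2 - θ ^ 2) * (z / (π1 * π2)) / 4) := by
    field_simp
    ring
  rw [e] at key
  have hf : 1 / 2 ≤ 1 - 1 / 4 - (d * θ ^ 2 - θ ^ 2) * (z / (π1 * π2)) / 4 := by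
    nlinarith [mul_nonneg (sq_nonneg θ) hq0, mul_le_mul_of_nonneg_right hd' hq0]
  have := mul_le_mul hd (mul_le_mul_of_nonneg_left hf hz) (by positivity) (by positivity)
  nlinarith

lemma variance_step_lower (h : IsDeviation π1 π2 θ p D) (h1 : 0 < π1) (h2 : 0 < π2)
    (hs : π1 + π2 = 1) (hd' : d * θ ^ 2 ≤ 1) :
    d * θ ^ 2 * ∑ ω, p ω * D ω ^ 2 ≤
      iidSum d p (fun a => Wmix π1 π2 θ D a * dev π1 π2 θ D a ^ 2) +
        (∑ ω, p ω * D ω ^ 2) ^ 2 / (π1 * π2) := by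
  have key := h.le_iidSum_dev_sq (d := d) h1 h2 hs θ
  set z := ∑ ω, p ω * D ω ^ 2
  have e : 2 * θ * (θ * d * z) - θ ^ 2 *
      (d * z + d * (d - 1) * (θ ^ 2 / (π1 * π2)) * z ^ 2) =
      d * θ ^ 2 * z - (d * θ ^ 2 * (d * θ ^ 2) - θ ^ 2 * (d * θ ^ 2)) * (z ^ 2 / (π1 * π2)) := by
    field_simp
    ring
  rw [e] at key
  have hq0 : 0 ≤ z ^ 2 / (π1 * π2) := by positivity
  have hdn : 0 ≤ d * θ ^ 2 := by positivity
  have hf : d * θ ^ 2 * (d * θ ^ 2) - θ ^ 2 * (d * θ ^ 2) ≤ 1 := by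
    nlinarith [mul_nonneg (sq_nonneg θ) hdn]
  linarith [mul_le_mul_of_nonneg_right hf hq0]

lemma add_pow_four_le (x y : ℝ) : (x + y) ^ 4 ≤ 3 / 2 * x ^ 4 + 1000 * y ^ 4 := by
  have h1 : 2 * x * y ≤ x ^ 2 / 9 + 9 * y ^ 2 := by nlinarith [sq_nonneg (x / 3 - 3 * y)]
  have h2 : (x + y) ^ 2 ≤ 10 / 9 * x ^ 2 + 10 * y ^ 2 := by linarith
  have h3 := pow_le_pow_left₀ (sq_nonneg (x + y)) h2 2
  nlinarith [sq_nonneg (x ^ 2 / 9 - 9 * y ^ 2), sq_nonneg (x ^ 2), sq_nonneg (y ^ 2),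
    sq_nonneg (x ^ 2 - 50 * y ^ 2)]

lemma abs_div_le_inv_mul (h1 : 0 < π1) (h2 : 0 < π2) (hs : π1 + π2 = 1) (hθ : |θ| ≤ 1) :
    |θ / π1| ≤ 1 / (π1 * π2) ∧ |θ / π2| ≤ 1 / (π1 * π2) := by
  rw [abs_div, abs_div, abs_of_pos h1, abs_of_pos h2]
  constructor
  · exact div_le_div₀ zero_le_one hθ (by positivity) (by nlinarith)
  · exact div_le_div₀ zero_le_one hθ (by positivity) (by nlinarith)

lemma mix_single (h1 : 0 < π1) (h2 : 0 < π2) (hs : π1 + π2 = 1) (t : ℝ) :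
    π1 * (1 + θ / π1 * t) + π2 * (1 - θ / π2 * t) = 1 := by
  field_simp
  linear_combination hs

lemma diff_single (h1 : 0 < π1) (h2 : 0 < π2) (hs : π1 + π2 = 1) (t : ℝ) :
    π1 * π2 * ((1 + θ / π1 * t) - (1 - θ / π2 * t)) = θ * t := by
  field_simp
  linear_combination (θ * t) * hs

lemma mix_pair (h1 : 0 < π1) (h2 : 0 < π2) (hs : π1 + π2 = 1) (s t : ℝ) :
    π1 * ((1 + θ / π1 * s) * (1 + θ / π1 * t)) + π2 * ((1 - θ / π2 * s) * (1 - θ / π2 * t)) - 1 =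
      θ ^ 2 * (1 / (π1 * π2)) * (s * t) := by
  field_simp
  linear_combination (π1 * π2 + θ ^ 2 * s * t) * hs

lemma diff_pair (h1 : 0 < π1) (h2 : 0 < π2) (hs : π1 + π2 = 1) (s t : ℝ) :
    π1 * π2 * ((1 + θ / π1 * s) * (1 + θ / π1 * t) - (1 - θ / π2 * s) * (1 - θ / π2 * t)) =
      θ * (s + t) + θ ^ 2 * (π2 - π1) * (1 / (π1 * π2)) * (s * t) := by
  field_simp
  linear_combination (θ * (s + t) * π1 * π2 + θ ^ 2 * s * t * (π2 - π1)) * hs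

lemma fourth_moment_step (d : ℕ) (h1 : 0 < π1) (h2 : 0 < π2) (hs : π1 + π2 = 1) :
    ∃ C : ℝ, 0 ≤ C ∧ ∀ (Ω : Type) [Fintype Ω] (p D : Ω → ℝ) (θ : ℝ), |θ| ≤ 1 →
      IsDeviation π1 π2 θ p D →
      iidSum d p (fun a => Wmix π1 π2 θ D a * dev π1 π2 θ D a ^ 4) ≤
        3 / 2 * (d * θ ^ 4) * ∑ ω, p ω * D ω ^ 4 + C * (∑ ω, p ω * D ω ^ 2) ^ 2 := by
  let W : MvPolynomial (Fin 2) ℝ := .C π1 * .X 0 + .C π2 * .X 1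
  let V : MvPolynomial (Fin 2) ℝ := .C (π1 * π2) * (.X 0 - .X 1)
  have hG : ∀ x y, evalPair (W * (.C (3 / 2) * V ^ 4 + .C 1000 * (1 - W) ^ 4)) x y =
      (π1 * x + π2 * y) * (3 / 2 * (π1 * π2 * (x - y)) ^ 4 +
        1000 * (1 - (π1 * x + π2 * y)) ^ 4) := fun x y => by
    simp [evalPair, W, V]
  obtain ⟨C, hC, hb⟩ := iidSum_evalPair_expansion d (1 / (π1 * π2))
    (W * (.C (3 / 2) * V ^ 4 + .C 1000 * (1 - W) ^ 4))
  refine ⟨C, hC, fun Ω _ p D θ hθ h => ?_⟩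
  obtain ⟨ha, hb'⟩ := abs_div_le_inv_mul h1 h2 hs hθ
  have key := (hb Ω p D (θ / π1) (θ / π2) h.nonneg h.sum_one h.mean_zero
    (h.abs_le_one h1 h2 hs) ha hb').1
  simp only [hG, mix_single h1 h2 hs, diff_single h1 h2 hs] at key
  have e1 : ∑ ω, p ω * (1 * (3 / 2 * (θ * D ω) ^ 4 + 1000 * (1 - 1) ^ 4) -
      (π1 * 1 + π2 * 1) * (3 / 2 * (π1 * π2 * (1 - 1)) ^ 4 +
        1000 * (1 - (π1 * 1 + π2 * 1)) ^ 4)) = 3 / 2 * θ ^ 4 * ∑ ω, p ω * D ω ^ 4 := by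
    rw [mul_one, mul_one, hs, Finset.mul_sum]
    exact Finset.sum_congr rfl fun ω _ => by ring
  rw [e1, mul_one, mul_one, hs] at key
  have key' := (abs_le.1 key).2
  have hle : iidSum d p (fun a => Wmix π1 π2 θ D a * dev π1 π2 θ D a ^ 4) ≤
      iidSum d p (fun a => Wmix π1 π2 θ D a *
        (3 / 2 * (π1 * π2 * (Zone π1 θ D a - Ztwo π2 θ D a)) ^ 4 +
          1000 * (1 - Wmix π1 π2 θ D a) ^ 4)) := by
    refine iidSum_mono h.nonneg fun a => mul_le_mul_of_nonneg_left ?_ (h.Wmix_pos h1 h2 a).le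
    have hX := pow_le_one₀ (n := 4) (abs_nonneg _) (h.abs_dev_le h1 h2 hs a)
    rw [← abs_pow, abs_of_nonneg (by positivity)] at hX
    have hQ : 0 ≤ (1 - Wmix π1 π2 θ D a) ^ 4 := by positivity
    calc dev π1 π2 θ D a ^ 4 = (π1 * π2 * (Zone π1 θ D a - Ztwo π2 θ D a) +
          dev π1 π2 θ D a * (1 - Wmix π1 π2 θ D a)) ^ 4 := by
            rw [← h.Wmix_mul_dev h1 h2 hs]; ring
      _ ≤ _ := add_pow_four_le _ _
      _ ≤ _ := by rw [mul_pow (dev _ _ _ _ _)]; nlinarith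
  simp only [Wmix, Zone, Ztwo] at hle key' ⊢
  linarith

lemma pair_bound {A θ s t c τ q : ℝ} (hA : 1 ≤ A) (hθ : |θ| ≤ 1) (hs : |s| ≤ 1) (ht : |t| ≤ 1)
    (hc : |c| ≤ A) (hτ : 0 < τ) (hq : |q| ≤ 1) :
    (1 + c * s) * (1 + c * t) * (θ ^ 2 * A * (s * t)) ^ 2 *
      (τ / 2 + ((θ * (s + t) + θ ^ 2 * q * A * (s * t)) ^ 2 + (θ ^ 2 * A * (s * t)) ^ 2) / τ) ≤
    θ ^ 4 * ((1 + A) ^ 2 * A ^ 2 * (τ / 2 * (s ^ 2 * t ^ 2) +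
      (3 + 4 * A ^ 2) / τ * (s ^ 4 * t ^ 2 + s ^ 2 * t ^ 4))) := by
  have hfac : ∀ r : ℝ, |r| ≤ 1 → |1 + c * r| ≤ 1 + A := fun r hr => by
    refine (abs_add_le _ _).trans ?_
    rw [abs_one, abs_mul]
    nlinarith [abs_nonneg c, abs_nonneg r]
  have hxx : (1 + c * s) * (1 + c * t) ≤ (1 + A) ^ 2 := by
    refine (le_abs_self _).trans ?_
    rw [abs_mul, sq]
    exact mul_le_mul (hfac s hs) (hfac t ht) (abs_nonneg _) (by linarith)
  have hθ2 : θ ^ 2 ≤ 1 := (sq_le_one_iff_abs_le_one θ).2 hθ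
  have hs2 : s ^ 2 ≤ 1 := (sq_le_one_iff_abs_le_one s).2 hs
  have ht2 : t ^ 2 ≤ 1 := (sq_le_one_iff_abs_le_one t).2 ht
  have hq2 : q ^ 2 ≤ 1 := (sq_le_one_iff_abs_le_one q).2 hq
  have hθ4 : θ ^ 4 ≤ 1 := by nlinarith [sq_nonneg θ]
  have hst : s ^ 2 * t ^ 2 ≤ s ^ 2 := mul_le_of_le_one_right (sq_nonneg s) ht2
  have hQ : (θ ^ 2 * A * (s * t)) ^ 2 ≤ A ^ 2 * (s ^ 2 + t ^ 2) := by
    calc (θ ^ 2 * A * (s * t)) ^ 2 = θ ^ 4 * (A ^ 2 * (s ^ 2 * t ^ 2)) := by ring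
      _ ≤ 1 * (A ^ 2 * (s ^ 2 + t ^ 2)) := by
        gcongr
        linarith [sq_nonneg t]
      _ = _ := one_mul _
  have hq' : (θ ^ 2 * q * A * (s * t)) ^ 2 ≤ A ^ 2 * (s ^ 2 + t ^ 2) := by
    calc (θ ^ 2 * q * A * (s * t)) ^ 2 = q ^ 2 * (θ ^ 2 * A * (s * t)) ^ 2 := by ring
      _ ≤ 1 * (θ ^ 2 * A * (s * t)) ^ 2 := by gcongr
      _ ≤ _ := by rw [one_mul]; exact hQ
  have hl : (θ * (s + t)) ^ 2 ≤ 2 * (s ^ 2 + t ^ 2) := by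
    calc (θ * (s + t)) ^ 2 = θ ^ 2 * (s + t) ^ 2 := by ring
      _ ≤ 1 * (s + t) ^ 2 := by gcongr
      _ ≤ _ := by nlinarith [sq_nonneg (s - t)]
  have hV : (θ * (s + t) + θ ^ 2 * q * A * (s * t)) ^ 2 ≤
      3 / 2 * (θ * (s + t)) ^ 2 + 3 * (θ ^ 2 * q * A * (s * t)) ^ 2 := by
    nlinarith [sq_nonneg (θ * (s + t) - 2 * (θ ^ 2 * q * A * (s * t)))]
  have hVQ : (θ * (s + t) + θ ^ 2 * q * A * (s * t)) ^ 2 + (θ ^ 2 * A * (s * t)) ^ 2 ≤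
      (3 + 4 * A ^ 2) * (s ^ 2 + t ^ 2) := by linarith
  calc _ ≤ (1 + A) ^ 2 * (θ ^ 2 * A * (s * t)) ^ 2 *
      (τ / 2 + (3 + 4 * A ^ 2) * (s ^ 2 + t ^ 2) / τ) := by gcongr
    _ = _ := by
      field_simp

lemma abs_iidSum_residual_le (d : ℕ) (h1 : 0 < π1) (h2 : 0 < π2) (hs : π1 + π2 = 1) {τ : ℝ}
    (hτ : 0 < τ) :
    ∃ C : ℝ, 0 ≤ C ∧ ∀ (Ω : Type) [Fintype Ω] (p D : Ω → ℝ) (θ : ℝ), |θ| ≤ 1 →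
      1 ≤ d → d * θ ^ 2 ≤ 1 → IsDeviation π1 π2 θ p D →
      |iidSum d p (fun a => Zone π1 θ D a * ((Wmix π1 π2 θ D a - 1) ^ 2 * dev π1 π2 θ D a))| ≤
        (1 + 1 / (π1 * π2)) ^ 2 * (1 / (π1 * π2)) ^ 2 * (τ * (∑ ω, p ω * D ω ^ 2) ^ 2 +
          (3 + 4 * (1 / (π1 * π2)) ^ 2) / τ *
            ((∑ ω, p ω * D ω ^ 2) * ∑ ω, p ω * D ω ^ 4)) +
        C * (∑ ω, p ω * D ω ^ 2) ^ 3 := by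
  let W : MvPolynomial (Fin 2) ℝ := .C π1 * .X 0 + .C π2 * .X 1
  let V : MvPolynomial (Fin 2) ℝ := .C (π1 * π2) * (.X 0 - .X 1)
  let G : MvPolynomial (Fin 2) ℝ :=
    .X 0 * (W - 1) ^ 2 * (.C (τ / 2) + .C (1 / τ) * (V ^ 2 + (W - 1) ^ 2))
  have hG : ∀ x y, evalPair G x y = x * (π1 * x + π2 * y - 1) ^ 2 *
      (τ / 2 + ((π1 * π2 * (x - y)) ^ 2 + (π1 * x + π2 * y - 1) ^ 2) / τ) := fun x y => by
    simp only [evalPair, G, W, V, map_mul, map_add, map_sub, map_pow, map_one,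
      MvPolynomial.eval_C, MvPolynomial.eval_X, Matrix.cons_val_zero, Matrix.cons_val_one]
    ring
  obtain ⟨C, hC, hb⟩ := iidSum_evalPair_expansion d (1 / (π1 * π2)) G
  refine ⟨C, hC, fun Ω _ p D θ hθ hd hd' h => ?_⟩
  obtain ⟨ha, hb'⟩ := abs_div_le_inv_mul h1 h2 hs hθ
  have key := (hb Ω p D (θ / π1) (θ / π2) h.nonneg h.sum_one h.mean_zero
    (h.abs_le_one h1 h2 hs) ha hb').2
  have hG1 : evalPair G 1 1 = 0 := by rw [hG]; simp [hs]
  have hGs : ∀ t : ℝ, evalPair G (1 + θ / π1 * t) (1 - θ / π2 * t) = 0 := fun t => by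
    rw [hG, mix_single h1 h2 hs]; simp
  simp only [hG1, hGs, sub_zero, add_zero, mul_zero, Finset.sum_const_zero] at key
  have hA : 1 ≤ 1 / (π1 * π2) := by
    rw [le_div_iff₀ (by positivity)]
    nlinarith
  have hle : |iidSum d p (fun a =>
      Zone π1 θ D a * ((Wmix π1 π2 θ D a - 1) ^ 2 * dev π1 π2 θ D a))| ≤
      iidSum d p (fun a => evalPair G (Zone π1 θ D a) (Ztwo π2 θ D a)) := by
    refine (Finset.abs_sum_le_sum_abs _ _).trans (Finset.sum_le_sum fun a _ => ?_)
    rw [abs_mul, abs_of_nonneg (Finset.prod_nonneg fun _ _ => h.nonneg _)]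
    refine mul_le_mul_of_nonneg_left ?_ (Finset.prod_nonneg fun _ _ => h.nonneg _)
    have hZ := h.Zone_pos a
    beta_reduce
    rw [abs_mul, abs_of_pos hZ, abs_mul, abs_of_nonneg (sq_nonneg _), hG, ← mul_assoc]
    refine mul_le_mul_of_nonneg_left ?_ (by positivity)
    have hX := (sq_le_one_iff_abs_le_one _).2 (h.abs_dev_le h1 h2 hs a)
    have hV := h.Wmix_mul_dev h1 h2 hs a
    change _ ≤ τ / 2 + (_ + (Wmix π1 π2 θ D a - 1) ^ 2) / τ
    rw [← hV]
    set X := dev π1 π2 θ D a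
    set w := Wmix π1 π2 θ D a
    have hX2 : X ^ 2 / 2 ≤ (w * X) ^ 2 + (w - 1) ^ 2 := by
      nlinarith [sq_nonneg (w * X + (w - 1) * X),
        mul_nonneg (sq_nonneg (w - 1)) (sub_nonneg.2 hX)]
    have hAM : |X| ≤ τ / 2 + X ^ 2 / 2 / τ := by
      have : τ / 2 + X ^ 2 / 2 / τ - |X| = (τ - |X|) ^ 2 / (2 * τ) := by
        rw [sub_sq, sq_abs]; field_simp; ring
      have : 0 ≤ (τ - |X|) ^ 2 / (2 * τ) := by positivity
      linarith
    refine hAM.trans ?_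
    gcongr
  refine hle.trans ?_
  have key' := (abs_le.1 key).2
  set z := ∑ ω, p ω * D ω ^ 2 with hz
  set m := ∑ ω, p ω * D ω ^ 4 with hm
  set A := 1 / (π1 * π2) with hAdef
  have hz0 : 0 ≤ z := h.second_moment_nonneg
  have hm0 : 0 ≤ m := Finset.sum_nonneg fun ω _ => mul_nonneg (h.nonneg ω) (by positivity)
  have hpair : ∑ ω, p ω * ∑ η, p η *
      evalPair G ((1 + θ / π1 * D ω) * (1 + θ / π1 * D η))
        ((1 - θ / π2 * D ω) * (1 - θ / π2 * D η)) ≤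
      θ ^ 4 * ((1 + A) ^ 2 * A ^ 2 * (τ / 2 * z ^ 2 + (3 + 4 * A ^ 2) / τ * (2 * (z * m)))) := by
    have hpt : ∀ ω η, p ω * (p η * evalPair G ((1 + θ / π1 * D ω) * (1 + θ / π1 * D η))
        ((1 - θ / π2 * D ω) * (1 - θ / π2 * D η))) ≤
        p ω * (p η * (θ ^ 4 * ((1 + A) ^ 2 * A ^ 2 * (τ / 2 * (D ω ^ 2 * D η ^ 2) +
          (3 + 4 * A ^ 2) / τ * (D ω ^ 4 * D η ^ 2 + D ω ^ 2 * D η ^ 4))))) := fun ω η => by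
      refine mul_le_mul_of_nonneg_left (mul_le_mul_of_nonneg_left ?_ (h.nonneg η)) (h.nonneg ω)
      rw [hG, mix_pair h1 h2 hs, diff_pair h1 h2 hs]
      exact pair_bound hA hθ (h.abs_le_one h1 h2 hs ω) (h.abs_le_one h1 h2 hs η) ha hτ
        (abs_le.2 ⟨by linarith, by linarith⟩)
    simp only [Finset.mul_sum]
    refine (Finset.sum_le_sum fun ω _ => Finset.sum_le_sum fun η _ => hpt ω η).trans (le_of_eq ?_)
    have e : ∀ ω η, p ω * (p η * (θ ^ 4 * ((1 + A) ^ 2 * A ^ 2 * (τ / 2 * (D ω ^ 2 * D η ^ 2) +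
          (3 + 4 * A ^ 2) / τ * (D ω ^ 4 * D η ^ 2 + D ω ^ 2 * D η ^ 4))))) =
        θ ^ 4 * (1 + A) ^ 2 * A ^ 2 * (τ / 2) * ((p ω * D ω ^ 2) * (p η * D η ^ 2)) +
        θ ^ 4 * (1 + A) ^ 2 * A ^ 2 * ((3 + 4 * A ^ 2) / τ) *
          ((p ω * D ω ^ 4) * (p η * D η ^ 2)) +
        θ ^ 4 * (1 + A) ^ 2 * A ^ 2 * ((3 + 4 * A ^ 2) / τ) *
          ((p ω * D ω ^ 2) * (p η * D η ^ 4)) := fun ω η => by ring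
    simp only [e, Finset.sum_add_distrib, ← Finset.mul_sum, ← Finset.sum_mul, ← hz, ← hm]
    ring
  have hd1 : (1 : ℝ) ≤ d := by exact_mod_cast hd
  have hcoef : d * (d - 1) / 2 * θ ^ 4 ≤ 1 / 2 := by
    have : d * (d - 1) / 2 * θ ^ 4 ≤ (d * θ ^ 2) ^ 2 / 2 := by
      nlinarith [mul_nonneg (by linarith : (0 : ℝ) ≤ d) (by positivity : 0 ≤ θ ^ 4)]
    nlinarith [mul_nonneg (by linarith : (0 : ℝ) ≤ d) (sq_nonneg θ)]
  have hdd : 0 ≤ (d : ℝ) * (d - 1) / 2 := by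
    have := mul_nonneg (by linarith : (0 : ℝ) ≤ d) (sub_nonneg.2 hd1)
    linarith
  have hR : 0 ≤ (1 + A) ^ 2 * A ^ 2 *
      (τ / 2 * z ^ 2 + (3 + 4 * A ^ 2) / τ * (2 * (z * m))) := by positivity
  have hfin := (mul_le_mul_of_nonneg_left hpair hdd).trans
    ((mul_assoc _ _ _).ge.trans (mul_le_mul_of_nonneg_right hcoef hR))
  have hextra : 0 ≤ (1 + A) ^ 2 * A ^ 2 * (τ * z ^ 2) := by positivity
  simp only [Zone, Ztwo]
  linarith

end IsDeviation

end Step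

section Tree

variable {π1 π2 θ : ℝ} {d : ℕ}

/-- The posterior deviation `f_n(1, A) - π₁`. -/
noncomputable def postDev (d : ℕ) (θ π1 π2 : ℝ) (n : ℕ) (A : LConf d n) : ℝ :=
  post d θ (Dlt θ π1 π2) n 0 A - π1

/-- The stationary `k`-th moment of the posterior deviation. -/
noncomputable def devMoment (d : ℕ) (θ π1 π2 : ℝ) (k n : ℕ) : ℝ :=
  ∑ A, levelProb d θ (Dlt θ π1 π2) n A * postDev d θ π1 π2 n A ^ k

/-- The parameter conditions used throughout. -/
structure Admissible (π1 π2 θ : ℝ) : Prop where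
  pos_one : 0 < π1
  pos_two : 0 < π2
  sum_one : π1 + π2 = 1
  theta_lt : θ < 1
  entries : ∀ i j, 0 < Mmat θ (Dlt θ π1 π2) i j

namespace Admissible

lemma pst_zero (h : Admissible π1 π2 θ) : pst θ (Dlt θ π1 π2) 0 = π1 := by
  have : 1 - θ ≠ 0 := (sub_pos.2 h.theta_lt).ne'
  simp only [pst, Dlt, if_true]
  field_simp
  linarith [h.sum_one]

lemma pst_one (h : Admissible π1 π2 θ) : pst θ (Dlt θ π1 π2) 1 = π2 := by
  have : 1 - θ ≠ 0 := (sub_pos.2 h.theta_lt).ne'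
  simp only [pst, Dlt, one_ne_zero, if_false]
  field_simp
  linarith [h.sum_one]

lemma pst_pos (h : Admissible π1 π2 θ) (i : Fin 2) : 0 < pst θ (Dlt θ π1 π2) i := by
  fin_cases i
  · exact h.pst_zero.symm ▸ h.pos_one
  · exact h.pst_one.symm ▸ h.pos_two

lemma Mmat_zero_zero (h : Admissible π1 π2 θ) :
    Mmat θ (Dlt θ π1 π2) 0 0 = π1 + θ * π2 := by
  simp only [Mmat, Dlt, if_true]
  linear_combination (-1 - θ) / 2 * h.sum_one

lemma Mmat_zero_one (h : Admissible π1 π2 θ) :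
    Mmat θ (Dlt θ π1 π2) 0 1 = (1 - θ) * π2 := by
  simp only [Mmat, Dlt, if_true, one_ne_zero, if_false]
  linear_combination (θ - 1) / 2 * h.sum_one

lemma Mmat_one_zero (h : Admissible π1 π2 θ) :
    Mmat θ (Dlt θ π1 π2) 1 0 = (1 - θ) * π1 := by
  simp only [Mmat, Dlt, if_true, one_ne_zero, if_false]
  linear_combination (θ - 1) / 2 * h.sum_one

lemma Mmat_one_one (h : Admissible π1 π2 θ) :
    Mmat θ (Dlt θ π1 π2) 1 1 = π2 + θ * π1 := by
  simp only [Mmat, Dlt, one_ne_zero, if_false]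
  linear_combination (-1 - θ) / 2 * h.sum_one

lemma jointProb_nonneg (h : Admissible π1 π2 θ) (n : ℕ) (i : Fin 2) (A : LConf d n) :
    0 ≤ jointProb d θ (Dlt θ π1 π2) n i A :=
  AsymIsing.jointProb_nonneg h.pst_pos h.entries n i A

lemma levelProb_nonneg (h : Admissible π1 π2 θ) (n : ℕ) (A : LConf d n) :
    0 ≤ levelProb d θ (Dlt θ π1 π2) n A := by
  rw [levelProb_eq_add]
  exact add_nonneg (h.jointProb_nonneg n 0 A) (h.jointProb_nonneg n 1 A)

lemma jointProb_zero (h : Admissible π1 π2 θ) (n : ℕ) (A : LConf d n) :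
    jointProb d θ (Dlt θ π1 π2) n 0 A =
      levelProb d θ (Dlt θ π1 π2) n A * (π1 + postDev d θ π1 π2 n A) := by
  rw [postDev, add_sub_cancel, post]
  by_cases hl : levelProb d θ (Dlt θ π1 π2) n A = 0
  · have h0 := h.jointProb_nonneg n 0 A
    have h1 := h.jointProb_nonneg n 1 A
    have := levelProb_eq_add d θ (Dlt θ π1 π2) n A
    rw [hl, zero_mul]
    linarith
  · rw [mul_div_cancel₀ _ hl]

lemma jointProb_one (h : Admissible π1 π2 θ) (n : ℕ) (A : LConf d n) :
    jointProb d θ (Dlt θ π1 π2) n 1 A =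
      levelProb d θ (Dlt θ π1 π2) n A * (π2 - postDev d θ π1 π2 n A) := by
  have := levelProb_eq_add d θ (Dlt θ π1 π2) n A
  rw [h.jointProb_zero] at this
  linear_combination -this - levelProb d θ (Dlt θ π1 π2) n A * h.sum_one

lemma sum_levelProb (h : Admissible π1 π2 θ) (n : ℕ) :
    ∑ A, levelProb d θ (Dlt θ π1 π2) n A = 1 := by
  have hne := fun i => (h.pst_pos i).ne'
  simp only [levelProb_eq_add, Finset.sum_add_distrib, sum_jointProb hne, h.pst_zero, h.pst_one,
    h.sum_one]

lemma isDeviation (h : Admissible π1 π2 θ) (n : ℕ) :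
    IsDeviation π1 π2 θ (levelProb d θ (Dlt θ π1 π2) n) (postDev d θ π1 π2 n) := by
  have hpost0 : ∀ A : LConf d n, 0 ≤ post d θ (Dlt θ π1 π2) n 0 A := fun A =>
    div_nonneg (h.jointProb_nonneg n 0 A) (h.levelProb_nonneg n A)
  have hpost1 : ∀ A : LConf d n, post d θ (Dlt θ π1 π2) n 0 A ≤ 1 := fun A =>
    div_le_one_of_le₀ (by
      rw [levelProb_eq_add]
      exact le_add_of_nonneg_right (h.jointProb_nonneg n 1 A)) (h.levelProb_nonneg n A)
  have hlo : ∀ A : LConf d n, -π1 ≤ postDev d θ π1 π2 n A := fun A => by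
    rw [postDev]; linarith [hpost0 A]
  have hup : ∀ A : LConf d n, postDev d θ π1 π2 n A ≤ π2 := fun A => by
    rw [postDev]; linarith [hpost1 A, h.sum_one]
  have hp1 := h.pos_one
  have hp2 := h.pos_two
  have hθ := h.theta_lt
  have h00 := h.entries 0 0
  have h11 := h.entries 1 1
  rw [h.Mmat_zero_zero] at h00
  rw [h.Mmat_one_one] at h11
  refine ⟨h.levelProb_nonneg n, h.sum_levelProb n, ?_, hlo, hup, fun A => ?_, fun A => ?_⟩
  · have hj := sum_jointProb (d := d) (fun i => (h.pst_pos i).ne') n 0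
    simp only [h.jointProb_zero, mul_add, Finset.sum_add_distrib, ← Finset.sum_mul,
      h.sum_levelProb, h.pst_zero] at hj
    linarith
  · have e : 1 + θ / π1 * postDev d θ π1 π2 n A = (π1 + θ * postDev d θ π1 π2 n A) / π1 := by
      field_simp
    rw [e]
    refine div_pos ?_ hp1
    rcases le_total 0 θ with ht | ht
    · nlinarith [mul_le_mul_of_nonneg_left (hlo A) ht, mul_pos hp1 (sub_pos.2 hθ)]
    · nlinarith [mul_le_mul_of_nonpos_left (hup A) ht]
  · have e : 1 - θ / π2 * postDev d θ π1 π2 n A = (π2 - θ * postDev d θ π1 π2 n A) / π2 := by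
      field_simp
    rw [e]
    refine div_pos ?_ hp2
    rcases le_total 0 θ with ht | ht
    · nlinarith [mul_le_mul_of_nonneg_left (hup A) ht, mul_pos hp2 (sub_pos.2 hθ)]
    · nlinarith [mul_le_mul_of_nonpos_left (hlo A) ht]

lemma jointProb_succ_zero (h : Admissible π1 π2 θ) (n : ℕ) (A : LConf d (n + 1)) :
    jointProb d θ (Dlt θ π1 π2) (n + 1) 0 A =
      (∏ j, levelProb d θ (Dlt θ π1 π2) n (restrictChild j A)) *
        (π1 * Zone π1 θ (postDev d θ π1 π2 n) fun j => restrictChild j A) := by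
  have hp1 := h.pos_one.ne'
  have hp2 := h.pos_two.ne'
  rw [jointProb_succ (fun i => (h.pst_pos i).ne'), h.pst_zero, Zone, mul_left_comm,
    ← Finset.prod_mul_distrib]
  refine congrArg _ (Finset.prod_congr rfl fun j _ => ?_)
  rw [Fin.sum_univ_two, h.Mmat_zero_zero, h.Mmat_zero_one, h.pst_zero, h.pst_one,
    h.jointProb_zero, h.jointProb_one]
  field_simp
  linear_combination (levelProb d θ (Dlt θ π1 π2) n (restrictChild j A) *
    (π1 + θ * postDev d θ π1 π2 n (restrictChild j A))) * h.sum_one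

lemma jointProb_succ_one (h : Admissible π1 π2 θ) (n : ℕ) (A : LConf d (n + 1)) :
    jointProb d θ (Dlt θ π1 π2) (n + 1) 1 A =
      (∏ j, levelProb d θ (Dlt θ π1 π2) n (restrictChild j A)) *
        (π2 * Ztwo π2 θ (postDev d θ π1 π2 n) fun j => restrictChild j A) := by
  have hp1 := h.pos_one.ne'
  have hp2 := h.pos_two.ne'
  rw [jointProb_succ (fun i => (h.pst_pos i).ne'), h.pst_one, Ztwo, mul_left_comm,
    ← Finset.prod_mul_distrib]
  refine congrArg _ (Finset.prod_congr rfl fun j _ => ?_)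
  rw [Fin.sum_univ_two, h.Mmat_one_zero, h.Mmat_one_one, h.pst_zero, h.pst_one,
    h.jointProb_zero, h.jointProb_one]
  field_simp
  linear_combination (levelProb d θ (Dlt θ π1 π2) n (restrictChild j A) *
    (π2 - θ * postDev d θ π1 π2 n (restrictChild j A))) * h.sum_one

lemma levelProb_succ (h : Admissible π1 π2 θ) (n : ℕ) (A : LConf d (n + 1)) :
    levelProb d θ (Dlt θ π1 π2) (n + 1) A =
      (∏ j, levelProb d θ (Dlt θ π1 π2) n (restrictChild j A)) *
        Wmix π1 π2 θ (postDev d θ π1 π2 n) fun j => restrictChild j A := by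
  rw [levelProb_eq_add, h.jointProb_succ_zero, h.jointProb_succ_one, Wmix, mul_add]

lemma devMoment_succ (h : Admissible π1 π2 θ) (k n : ℕ) :
    devMoment d θ π1 π2 k (n + 1) = iidSum d (levelProb d θ (Dlt θ π1 π2) n) (fun a =>
      Wmix π1 π2 θ (postDev d θ π1 π2 n) a * dev π1 π2 θ (postDev d θ π1 π2 n) a ^ k) := by
  rw [devMoment, iidSum, ← (levelEquiv d n).sum_comp]
  refine Finset.sum_congr rfl fun A _ => ?_
  change _ = (∏ j, levelProb d θ (Dlt θ π1 π2) n (restrictChild j A)) *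
    (Wmix π1 π2 θ (postDev d θ π1 π2 n) (fun j => restrictChild j A) *
      dev π1 π2 θ (postDev d θ π1 π2 n) (fun j => restrictChild j A) ^ k)
  rw [postDev, post, h.jointProb_succ_zero, h.levelProb_succ, dev]
  by_cases hl : ∏ j, levelProb d θ (Dlt θ π1 π2) n (restrictChild j A) = 0
  · simp only [hl, zero_mul]
  · rw [mul_div_mul_left _ _ hl, mul_assoc]

lemma Sterm_eq (h : Admissible π1 π2 θ) (n : ℕ) :
    Sterm d θ (Dlt θ π1 π2) n = iidSum d (levelProb d θ (Dlt θ π1 π2) n) (fun a =>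
      Zone π1 θ (postDev d θ π1 π2 n) a * ((Wmix π1 π2 θ (postDev d θ π1 π2 n) a - 1) ^ 2 *
        dev π1 π2 θ (postDev d θ π1 π2 n) a)) := by
  rw [Sterm, expect1, iidSum, ← (levelEquiv d n).sum_comp]
  refine Finset.sum_congr rfl fun A _ => ?_
  have hZ1 : Z1fun d θ (Dlt θ π1 π2) n A =
      Zone π1 θ (postDev d θ π1 π2 n) (levelEquiv d n A) := by
    rw [Z1fun, h.pst_zero]; rfl
  have hZ2 : Z2fun d θ (Dlt θ π1 π2) n A =
      Ztwo π2 θ (postDev d θ π1 π2 n) (levelEquiv d n A) := by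
    rw [Z2fun, h.pst_zero, h.pst_one]; rfl
  have hp1 := h.pos_one.ne'
  have e : ∀ P Z : ℝ, P * (π1 * Z) / π1 = P * Z := fun P Z => by field_simp
  rw [hZ1, hZ2, condLevel, h.jointProb_succ_zero, h.pst_zero, h.pst_one, e, mul_assoc]
  rfl

lemma xseq_eq (h : Admissible π1 π2 θ) (n : ℕ) :
    devMoment d θ π1 π2 2 n = π1 * xseq d θ (Dlt θ π1 π2) n := by
  have hp1 := h.pos_one.ne'
  have hdev := h.isDeviation (d := d) n
  rw [xseq, expect1, h.pst_zero, mul_sub, Finset.mul_sum]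
  have e : ∀ A : LConf d n, π1 * (condLevel d θ (Dlt θ π1 π2) n 0 A *
      post d θ (Dlt θ π1 π2) n 0 A) =
      levelProb d θ (Dlt θ π1 π2) n A * postDev d θ π1 π2 n A ^ 2 +
        2 * π1 * (levelProb d θ (Dlt θ π1 π2) n A * postDev d θ π1 π2 n A) +
        π1 ^ 2 * levelProb d θ (Dlt θ π1 π2) n A := fun A => by
    have : post d θ (Dlt θ π1 π2) n 0 A = π1 + postDev d θ π1 π2 n A := by
      rw [postDev, add_sub_cancel]
    rw [condLevel, h.jointProb_zero, h.pst_zero, this]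
    field_simp
    ring
  simp only [e, Finset.sum_add_distrib, ← Finset.mul_sum, hdev.mean_zero, hdev.sum_one, devMoment]
  ring

end Admissible

lemma fourth_moment_iterate {z m : ℕ → ℝ} {K : ℝ} (hK : 0 ≤ K) (hz : ∀ n, 0 ≤ z n)
    (hm : ∀ n, m n ≤ z n) (h4 : ∀ n, z n ≤ 4 * z (n + 1))
    (hstep : ∀ n r, 0 ≤ r → r ≤ 2 → m n ≤ r * z n → m (n + 1) ≤ (3 / 4 * r + K * z n) * z (n + 1))
    (k n : ℕ) {η : ℝ} (hη : z (n + k) ≤ η) (hη1 : 4 * K * 4 ^ k * η ≤ 1) :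
    m (n + k) ≤ ((3 / 4) ^ k + 4 * K * 4 ^ k * η) * z (n + k) := by
  induction k generalizing η with
  | zero =>
    have h0 : 0 ≤ 4 * K * 4 ^ 0 * η := mul_nonneg (by positivity) ((hz _).trans hη)
    nlinarith [hm (n + 0), hz (n + 0), mul_nonneg h0 (hz (n + 0))]
  | succ k ih =>
    have hη0 : 0 ≤ η := (hz _).trans hη
    have hzk : z (n + k) ≤ 4 * η := (h4 _).trans (by
      have : z (n + k + 1) ≤ η := hη
      linarith)
    have e : 4 * K * 4 ^ k * (4 * η) = 4 * K * 4 ^ (k + 1) * η := by ring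
    have hprev := ih hzk (by rw [e]; exact hη1)
    rw [e] at hprev
    have h34 : ((3 : ℝ) / 4) ^ k ≤ 1 := pow_le_one₀ (by norm_num) (by norm_num)
    have hs := hstep (n + k) ((3 / 4) ^ k + 4 * K * 4 ^ (k + 1) * η) (by positivity)
      (by linarith) hprev
    refine hs.trans (mul_le_mul_of_nonneg_right ?_ (hz _))
    have hp : (1 : ℝ) ≤ 4 ^ k := one_le_pow₀ (by norm_num)
    have : K * z (n + k) ≤ K * 4 ^ (k + 1) * η := by
      calc K * z (n + k) ≤ K * (4 * η) := mul_le_mul_of_nonneg_left hzk hK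
        _ = K * η * 4 * 1 := by ring
        _ ≤ K * η * 4 * 4 ^ k := by gcongr
        _ = _ := by ring
    rw [pow_succ (3 / 4 : ℝ)]
    linarith

lemma devMoment_four_le (d : ℕ) (h1 : 0 < π1) (h2 : 0 < π2) (hs : π1 + π2 = 1) :
    ∃ K : ℝ, 0 ≤ K ∧ ∀ θ : ℝ, Admissible π1 π2 θ → θ ^ 2 ≤ 1 / 2 → 1 / 2 ≤ d * θ ^ 2 →
      d * θ ^ 2 ≤ 1 → ∀ (k n : ℕ) {η : ℝ}, devMoment d θ π1 π2 2 (n + k) ≤ η →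
      4 * K * 4 ^ k * η ≤ 1 → devMoment d θ π1 π2 4 (n + k) ≤
        ((3 / 4) ^ k + 4 * K * 4 ^ k * η) * devMoment d θ π1 π2 2 (n + k) := by
  obtain ⟨C, hC, hstep⟩ := IsDeviation.fourth_moment_step d h1 h2 hs
  refine ⟨6 * (1 / (π1 * π2)) + 4 * C, by positivity, fun θ h hθ hd hd' k n η => ?_⟩
  have hz : ∀ n, 0 ≤ devMoment d θ π1 π2 2 n := fun n => (h.isDeviation n).second_moment_nonneg
  have h4 : ∀ n, devMoment d θ π1 π2 2 n ≤ 4 * devMoment d θ π1 π2 2 (n + 1) := fun n => by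
    rw [h.devMoment_succ]
    exact (h.isDeviation n).variance_le_four_mul h1 h2 hs hd hd'
  refine fourth_moment_iterate (by positivity) hz
    (fun n => (h.isDeviation n).fourth_moment_le h1 h2 hs) h4 (fun n r hr hr2 hm => ?_) k n
  have hθ1 : |θ| ≤ 1 := (sq_le_one_iff_abs_le_one θ).1 (by linarith)
  have hb := hstep _ _ _ θ hθ1 (h.isDeviation (d := d) n)
  have hl := (h.isDeviation (d := d) n).variance_step_lower h1 h2 hs hd'
  rw [← h.devMoment_succ] at hb hl
  have h4n := h4 n
  change _ ≤ 3 / 2 * (d * θ ^ 4) * devMoment d θ π1 π2 4 n +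
    C * devMoment d θ π1 π2 2 n ^ 2 at hb
  change d * θ ^ 2 * devMoment d θ π1 π2 2 n ≤
    _ + devMoment d θ π1 π2 2 n ^ 2 / (π1 * π2) at hl
  have hzn := hz n
  have hzn' := hz (n + 1)
  change devMoment d θ π1 π2 4 n ≤ r * devMoment d θ π1 π2 2 n at hm
  change devMoment d θ π1 π2 4 (n + 1) ≤ _
  set z := devMoment d θ π1 π2 2 n
  set z' := devMoment d θ π1 π2 2 (n + 1)
  set m := devMoment d θ π1 π2 4 n
  have hzz : z ^ 2 ≤ 4 * (z * z') := by nlinarith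
  have hA : 0 ≤ 1 / (π1 * π2) := by positivity
  have hzA : z ^ 2 / (π1 * π2) ≤ 1 / (π1 * π2) * (4 * (z * z')) := by
    rw [div_eq_mul_one_div, mul_comm]
    exact mul_le_mul_of_nonneg_left hzz hA
  have hfirst : 3 / 2 * (d * θ ^ 4) * m ≤ 3 / 4 * r * (d * θ ^ 2 * z) := by
    calc 3 / 2 * (d * θ ^ 4) * m ≤ 3 / 2 * (d * θ ^ 4) * (r * z) := by gcongr
      _ = 3 / 2 * θ ^ 2 * (r * (d * θ ^ 2 * z)) := by ring
      _ ≤ 3 / 2 * (1 / 2) * (r * (d * θ ^ 2 * z)) := by gcongr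
      _ = _ := by ring
  have hsecond : 3 / 4 * r * (d * θ ^ 2 * z) ≤
      3 / 4 * r * (z' + 1 / (π1 * π2) * (4 * (z * z'))) := by
    gcongr
    linarith
  have hthird : 3 / 4 * r * (1 / (π1 * π2) * (4 * (z * z'))) ≤
      3 / 4 * 2 * (1 / (π1 * π2) * (4 * (z * z'))) := by gcongr
  have hlast := mul_le_mul_of_nonneg_left hzz hC
  linarith

end Tree

lemma Sterm_bound_of_degree {π1 π2 : ℝ} (h1 : 0 < π1) (h2 : 0 < π2) (hs : π1 + π2 = 1) {ε : ℝ}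
    (hε : 0 < ε) :
    ∃ N : ℕ, ∀ d : ℕ, 2 ≤ d → ∃ δ : ℝ, 0 < δ ∧ ∀ θ : ℝ, Admissible π1 π2 θ →
      1 / 2 ≤ (d : ℝ) * θ ^ 2 → (d : ℝ) * θ ^ 2 ≤ 1 →
        ∀ n : ℕ, N ≤ n → xseq d θ (Dlt θ π1 π2) n ≤ δ →
          |Sterm d θ (Dlt θ π1 π2) n| ≤ ε * xseq d θ (Dlt θ π1 π2) n ^ 2 := by
  set B : ℝ := (1 + 1 / (π1 * π2)) ^ 2 * (1 / (π1 * π2)) ^ 2 with hB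
  set E : ℝ := 3 + 4 * (1 / (π1 * π2)) ^ 2 with hE
  have hB0 : 0 < B := by positivity
  have hE0 : 0 < E := by positivity
  set τ : ℝ := ε / (3 * B) with hτ
  have hτ0 : 0 < τ := by positivity
  set r : ℝ := ε * τ / (3 * B * E) with hr
  have hr0 : 0 < r := by positivity
  obtain ⟨N, hN⟩ := exists_pow_lt_of_lt_one (half_pos hr0) (by norm_num : (3 / 4 : ℝ) < 1)
  refine ⟨N, fun d hd => ?_⟩
  obtain ⟨K, hK, hfour⟩ := devMoment_four_le d h1 h2 hs
  obtain ⟨C, hC, hres⟩ := IsDeviation.abs_iidSum_residual_le d h1 h2 hs hτ0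
  set μ : ℝ := min 1 (min (r / 2) (ε / 3)) with hμ
  have hμ0 : 0 < μ := lt_min one_pos (lt_min (by positivity) (by positivity))
  have hden : 0 < 4 * K * 4 ^ N + C + 1 := by positivity
  refine ⟨μ / (4 * K * 4 ^ N + C + 1), by positivity, fun θ h hdθ hdθ' n hn hx => ?_⟩
  set δ : ℝ := μ / (4 * K * 4 ^ N + C + 1) with hδ
  have hδ0 : 0 < δ := by positivity
  have hδeq : (4 * K * 4 ^ N + C + 1) * δ = μ := mul_div_cancel₀ _ hden.ne'
  have hKδ : 4 * K * 4 ^ N * δ ≤ μ := by nlinarith [mul_nonneg hC hδ0.le]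
  have hCδ : C * δ ≤ μ := by
    nlinarith [mul_nonneg (by positivity : 0 ≤ 4 * K * 4 ^ N) hδ0.le]
  have hμ1 : μ ≤ 1 := min_le_left _ _
  have hμr : μ ≤ r / 2 := (min_le_right _ _).trans (min_le_left _ _)
  have hμε : μ ≤ ε / 3 := (min_le_right _ _).trans (min_le_right _ _)
  have hd2 : (2 : ℝ) ≤ d := by exact_mod_cast hd
  have hθ2 : θ ^ 2 ≤ 1 / 2 := by nlinarith [sq_nonneg θ]
  have hθ1 : |θ| ≤ 1 := (sq_le_one_iff_abs_le_one θ).1 (by linarith)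
  have hxz := h.xseq_eq (d := d) n
  have hz0 : 0 ≤ devMoment d θ π1 π2 2 n := (h.isDeviation n).second_moment_nonneg
  have hx0 : 0 ≤ xseq d θ (Dlt θ π1 π2) n := by
    rw [hxz] at hz0
    exact nonneg_of_mul_nonneg_right hz0 h1
  have hzx : devMoment d θ π1 π2 2 n ≤ xseq d θ (Dlt θ π1 π2) n := by
    rw [hxz]
    exact mul_le_of_le_one_left hx0 (by linarith)
  have hzδ := hzx.trans hx
  have hm : devMoment d θ π1 π2 4 n ≤ r * devMoment d θ π1 π2 2 n := by
    have := hfour θ h hθ2 hdθ hdθ' N (n - N) (η := δ) (by rwa [Nat.sub_add_cancel hn])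
      (hKδ.trans hμ1)
    rw [Nat.sub_add_cancel hn] at this
    exact this.trans (mul_le_mul_of_nonneg_right (by linarith) hz0)
  have hS := hres _ _ _ θ hθ1 (by omega) hdθ' (h.isDeviation (d := d) n)
  rw [← h.Sterm_eq] at hS
  change _ ≤ B * (τ * devMoment d θ π1 π2 2 n ^ 2 + E / τ *
    (devMoment d θ π1 π2 2 n * devMoment d θ π1 π2 4 n)) + C * devMoment d θ π1 π2 2 n ^ 3 at hS
  set z := devMoment d θ π1 π2 2 n
  set m := devMoment d θ π1 π2 4 n
  have t1 : B * (τ * z ^ 2) = ε / 3 * z ^ 2 := by rw [hτ]; field_simp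
  have t2 : B * (E / τ * (z * m)) ≤ ε / 3 * z ^ 2 := by
    calc B * (E / τ * (z * m)) ≤ B * (E / τ * (z * (r * z))) := by gcongr
      _ = _ := by rw [hr]; field_simp
  have t3 : C * z ^ 3 ≤ ε / 3 * z ^ 2 := by
    calc C * z ^ 3 = C * z * z ^ 2 := by ring
      _ ≤ C * δ * z ^ 2 := by gcongr
      _ ≤ _ := by gcongr; exact hCδ.trans hμε
  have hzx2 : ε * z ^ 2 ≤ ε * xseq d θ (Dlt θ π1 π2) n ^ 2 := by gcongr
  linarith

/-- Fix `ϱ > 0` and assume `|θ| > ϱ` and `1/2 ≤ dθ² ≤ 1`. For any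
`ε > 0` there exist `N = N(π, ε)` and `δ = δ(π, ε, ϱ) > 0` such that if `n ≥ N` and
`x_n ≤ δ` then `|S| ≤ ε x_n²`. -/
theorem Sterm_bound (π1 π2 : ℝ) (hsum : π1 + π2 = 1) (hord : π2 ≤ π1) (hpi2 : 0 < π2) :
    ∀ ε : ℝ, 0 < ε → ∃ N : ℕ, ∀ ϱ : ℝ, 0 < ϱ → ∃ δ : ℝ, 0 < δ ∧
      ∀ d : ℕ, 2 ≤ d → ∀ θ : ℝ, ϱ < |θ| →
        (∀ i j, 0 < Mmat θ (Dlt θ π1 π2) i j) →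
        1 / 2 ≤ (d : ℝ) * θ ^ 2 → (d : ℝ) * θ ^ 2 ≤ 1 →
        ∀ n : ℕ, N ≤ n → xseq d θ (Dlt θ π1 π2) n ≤ δ →
          |Sterm d θ (Dlt θ π1 π2) n| ≤ ε * xseq d θ (Dlt θ π1 π2) n ^ 2 := by
  intro ε hε
  have h1 : 0 < π1 := hpi2.trans_le hord
  obtain ⟨N, hN⟩ := Sterm_bound_of_degree h1 hpi2 hsum hε
  choose! δ hδ hbound using hN
  refine ⟨N, fun ϱ hϱ => ?_⟩
  have hne : (Finset.range (⌊1 / ϱ ^ 2⌋₊ + 1)).Nonempty := Finset.nonempty_range_add_one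
  refine ⟨(Finset.range (⌊1 / ϱ ^ 2⌋₊ + 1)).inf' hne (fun d => if 2 ≤ d then δ d else 1),
    ?_, fun d hd θ hθ hM hdθ hdθ' n hn hx => ?_⟩
  · refine (Finset.lt_inf'_iff hne).2 fun d _ => ?_
    split_ifs with hd
    · exact hδ d hd
    · exact one_pos
  · have hd2 : (2 : ℝ) ≤ d := by exact_mod_cast hd
    have hθ1 : |θ| < 1 := (sq_lt_one_iff_abs_lt_one θ).1 (by nlinarith [sq_nonneg θ])
    have hmem : d ∈ Finset.range (⌊1 / ϱ ^ 2⌋₊ + 1) := by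
      refine Finset.mem_range.2 (Nat.lt_succ_of_le (Nat.le_floor ?_))
      rw [le_div_iff₀ (by positivity)]
      refine le_trans (mul_le_mul_of_nonneg_left ?_ d.cast_nonneg) hdθ'
      rw [← sq_abs θ]
      exact pow_le_pow_left₀ hϱ.le hθ.le 2
    have hle := Finset.inf'_le (fun d => if 2 ≤ d then δ d else 1) hmem
    simp only [hd, if_true] at hle
    exact hbound d hd θ ⟨h1, hpi2, hsum, (le_abs_self θ).trans_lt hθ1, hM⟩ hdθ hdθ' n hn
      (hx.trans hle)

end AsymIsing
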